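/- Let d ≥ 1, 1 ≤ p,q ≤ ∞ and α, β > 0. There exists a constant C such that ‖f‖_q ≤ C ( ‖ |x|^α f ‖_q + ‖ |ξ|^β f̂ ‖_p ) for all Schwartz functions f on ℝ^d if and only if both of the following hold: (A) either (1 ≤ p ≤ q < ∞ and β = d(1 − 1/q − 1/p)) or β > d(1 − 1/q − 1/p); and (B) either q ≥ 2, or (p ≤ 2 and q ≤ 2), or (q < 2 < p and β > d(1/2 − 1/p)). -/

import Mathlib

open MeasureTheory
open scoped ENNReal FourierTransform

set_option linter.unusedSectionVars false

namespace NonsymmetricHeisenberg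
open Set Filter Topology Module

section

variable {V : Type*} [NormedAddCommGroup V] [InnerProductSpace ℝ V] [FiniteDimensional ℝ V]
  [MeasurableSpace V] [BorelSpace V]

theorem continuous_fourierInv {F : V → ℂ} (hF : Integrable F) : Continuous (𝓕⁻ F) := by
  rw [Real.fourierInv_eq_fourier_comp_neg]
  exact VectorFourier.fourierIntegral_continuous Real.continuous_fourierChar
    (by exact continuous_inner) hF.comp_neg

theorem enorm_fourierInv_le_lintegral (F : V → ℂ) (x : V) :
    ‖𝓕⁻ F x‖ₑ ≤ ∫⁻ ξ, ‖F ξ‖ₑ := by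
  rw [Real.fourierInv_eq]
  refine (enorm_integral_le_lintegral_enorm _).trans_eq ?_
  simp [Circle.smul_def, ← ofReal_norm, Circle.norm_coe]

theorem integral_smul_fourierInv {F : V → ℂ} (hF : Integrable F) (φ : SchwartzMap V ℂ) :
    ∫ x, φ x • 𝓕⁻ F x = ∫ ξ, (𝓕⁻ φ) ξ • F ξ := by
  have := VectorFourier.integral_fourierIntegral_smul_eq_flip (L := innerₗ V)
    (μ := volume) (ν := volume) Real.continuous_fourierChar (by exact continuous_inner)
    hF.comp_neg φ.integrable
  have h1 : ∀ w, VectorFourier.fourierIntegral 𝐞 volume (innerₗ V) (fun v => F (-v)) w = 𝓕⁻ F w := by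
    intro w
    rw [Real.fourierInv_eq_fourier_comp_neg]; rfl
  have h2 : ∀ w, VectorFourier.fourierIntegral 𝐞 volume (innerₗ V).flip (⇑φ) w = 𝓕 (⇑φ) w := by
    intro w
    rw [flip_innerₗ]; rfl
  simp only [h1, h2] at this
  calc _ = ∫ x, 𝓕⁻ F x • φ x := by simp only [smul_eq_mul, mul_comm]
    _ = _ := this
    _ = ∫ ξ, F ξ • 𝓕 (⇑φ) (-ξ) := by
      rw [← integral_neg_eq_self]; simp
    _ = _ := by
      simp only [SchwartzMap.fourierInv_coe, Real.fourierInv_eq_fourier_neg, smul_eq_mul, mul_comm]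

theorem eLpNorm_two_fourierInv {F : V → ℂ} (hF : Integrable F) (hF2 : MemLp F 2) :
    eLpNorm (𝓕⁻ F) 2 = eLpNorm F 2 := by
  have key : (𝓕⁻ (hF2.toLp F) : Lp ℂ 2 (volume : Measure V)) =ᵐ[volume] 𝓕⁻ F := by
    refine ae_eq_of_integral_contDiff_smul_eq ((Lp.memLp _).locallyIntegrable (by norm_num))
      (continuous_fourierInv hF).locallyIntegrable fun g hg hg' => ?_
    have hg₁ : HasCompactSupport (Complex.ofRealCLM ∘ g) := hg'.comp_left rfl
    have hg₂ : ContDiff ℝ (⊤ : ℕ∞) (Complex.ofRealCLM ∘ g) := by fun_prop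
    set φ : SchwartzMap V ℂ := hg₁.toSchwartzMap hg₂ with hφ
    have hφg : ∀ x, φ x = g x := fun x => rfl
    have h1 : (Lp.toTemperedDistribution (𝓕⁻ (hF2.toLp F) : Lp ℂ 2 (volume : Measure V))) φ =
        (Lp.toTemperedDistribution (hF2.toLp F)) (𝓕⁻ φ) := by
      rw [← Lp.fourierInv_toTemperedDistribution_eq, TemperedDistribution.fourierInv_apply]
    rw [Lp.toTemperedDistribution_apply, Lp.toTemperedDistribution_apply] at h1
    have h2 : ∫ ξ, (𝓕⁻ φ) ξ • (hF2.toLp F : V → ℂ) ξ = ∫ ξ, (𝓕⁻ φ) ξ • F ξ := by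
      refine integral_congr_ae ?_
      filter_upwards [hF2.coeFn_toLp] with x hx
      rw [hx]
    rw [h2, ← integral_smul_fourierInv hF φ] at h1
    simpa [hφg] using h1
  rw [← eLpNorm_congr_ae key, ← eLpNorm_congr_ae hF2.coeFn_toLp]
  have h3 : ‖(𝓕⁻ (hF2.toLp F) : Lp ℂ 2 (volume : Measure V))‖ = ‖hF2.toLp F‖ := by
    rw [← Lp.norm_fourier_eq (𝓕⁻ (hF2.toLp F)), FourierTransform.fourier_fourierInv_eq]
  rw [Lp.norm_def, Lp.norm_def, ENNReal.toReal_eq_toReal_iff' (Lp.eLpNorm_ne_top _)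
    (Lp.eLpNorm_ne_top _)] at h3
  exact h3

theorem fourierInv_add {F G : V → ℂ} (hF : Integrable F) (hG : Integrable G) (x : V) :
    𝓕⁻ (fun ξ => F ξ + G ξ) x = 𝓕⁻ F x + 𝓕⁻ G x := by
  have h : ∀ {H : V → ℂ}, Integrable H → Integrable fun v => 𝐞 (inner ℝ v x) • H v := by
    intro H hH
    have := (Real.fourierIntegral_convergent_iff (μ := volume) (f := H) (-x)).2 hH
    simpa using this
  simp only [Real.fourierInv_eq, smul_add]
  exact integral_add (h hF) (h hG)

theorem lintegral_enorm_sq_eq_eLpNorm (F : V → ℂ) :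
    ∫⁻ x, ‖F x‖ₑ ^ (2 : ℝ) = eLpNorm F 2 ^ 2 := by
  rw [eLpNorm_eq_lintegral_rpow_enorm_toReal (by simp) (by simp)]
  rw [← ENNReal.rpow_natCast, ← ENNReal.rpow_mul]
  norm_num

theorem measure_lt_norm_fourierInv_le {F : V → ℂ} (hF : Integrable F) (hF2 : MemLp F 2)
    {S : Set V} (hS : MeasurableSet S) {t : ℝ} (ht : 0 < t)
    (h : ∫⁻ ξ in S, ‖F ξ‖ₑ ≤ ENNReal.ofReal t) :
    volume {x : V | t < ‖𝓕⁻ F x‖ / 2} ≤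
      ENNReal.ofReal (t ^ (-2 : ℝ)) * ∫⁻ ξ in Sᶜ, ‖F ξ‖ₑ ^ (2 : ℝ) := by
  have hadd : ∀ x, 𝓕⁻ F x = 𝓕⁻ (S.indicator F) x + 𝓕⁻ (Sᶜ.indicator F) x := by
    intro x
    rw [← fourierInv_add (hF.indicator hS) (hF.indicator hS.compl)]
    exact congrArg (fun G : V → ℂ => 𝓕⁻ G x)
      (funext fun ξ => (congrFun (Set.indicator_self_add_compl S F) ξ).symm)
  have hlow : ∀ x, ‖𝓕⁻ (S.indicator F) x‖ ≤ t := by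
    intro x
    have h1 := (enorm_fourierInv_le_lintegral (S.indicator F) x).trans_eq
      (by simp only [enorm_indicator_eq_indicator_enorm]; exact lintegral_indicator hS _)
    have h2 := h1.trans h
    rw [← ofReal_norm] at h2
    exact (ENNReal.ofReal_le_ofReal_iff ht.le).1 h2
  have hpl : ∫⁻ x, ‖𝓕⁻ (Sᶜ.indicator F) x‖ₑ ^ (2 : ℝ) = ∫⁻ ξ in Sᶜ, ‖F ξ‖ₑ ^ (2 : ℝ) := by
    rw [lintegral_enorm_sq_eq_eLpNorm, eLpNorm_two_fourierInv (hF.indicator hS.compl)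
      (hF2.indicator hS.compl), ← lintegral_enorm_sq_eq_eLpNorm, ← lintegral_indicator hS.compl]
    congr 1 with ξ
    by_cases hξ : ξ ∈ S <;> simp [hξ]
  have hch := mul_meas_ge_le_lintegral (μ := (volume : Measure V))
    (f := fun x => ‖𝓕⁻ (Sᶜ.indicator F) x‖ₑ ^ (2 : ℝ))
    ((continuous_fourierInv (hF.indicator hS.compl)).measurable.enorm.pow_const _)
    (ENNReal.ofReal (t ^ (2 : ℝ)))
  rw [hpl] at hch
  have hsub : {x : V | t < ‖𝓕⁻ F x‖ / 2} ⊆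
      {x | ENNReal.ofReal (t ^ (2 : ℝ)) ≤ ‖𝓕⁻ (Sᶜ.indicator F) x‖ₑ ^ (2 : ℝ)} := by
    intro x hx
    simp only [mem_ofPred_eq] at hx ⊢
    have h3 : t ≤ ‖𝓕⁻ (Sᶜ.indicator F) x‖ := by
      have := norm_add_le (𝓕⁻ (S.indicator F) x) (𝓕⁻ (Sᶜ.indicator F) x)
      rw [← hadd] at this
      linarith [hlow x]
    rw [← ENNReal.ofReal_rpow_of_nonneg ht.le (by norm_num), ← ofReal_norm]
    gcongr
  calc volume {x : V | t < ‖𝓕⁻ F x‖ / 2}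
      = ENNReal.ofReal (t ^ (-2 : ℝ)) * (ENNReal.ofReal (t ^ (2 : ℝ)) *
          volume {x : V | t < ‖𝓕⁻ F x‖ / 2}) := by
        rw [← mul_assoc, ← ENNReal.ofReal_mul (by positivity), ← Real.rpow_add ht]
        simp
    _ ≤ _ := by
        gcongr
        exact (mul_le_mul_right (measure_mono hsub) _).trans hch

theorem lintegral_Ioo_rpow {a r : ℝ} (ha : 0 ≤ a) (hr : 0 < r) :
    ∫⁻ t in Ioo 0 a, ENNReal.ofReal (t ^ (r - 1)) = ENNReal.ofReal (a ^ r / r) := by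
  have hi : IntervalIntegrable (fun t : ℝ => t ^ (r - 1)) volume 0 a :=
    intervalIntegral.intervalIntegrable_rpow' (by linarith)
  rw [← ofReal_integral_eq_lintegral_ofReal]
  · rw [← integral_Ioc_eq_integral_Ioo, ← intervalIntegral.integral_of_le ha,
      integral_rpow (Or.inl (by linarith))]
    simp [Real.zero_rpow hr.ne']
  · exact ((intervalIntegrable_iff_integrableOn_Ioc_of_le ha).1 hi).mono_set Ioo_subset_Ioc_self
  · refine (ae_restrict_iff' measurableSet_Ioo).2 (Eventually.of_forall fun t ht => ?_)
    exact Real.rpow_nonneg ht.1.le _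

/-- A distributional form of the Paley inequality: if `A` controls the mass of `F` on its sublevel
sets, then the `L^q` norm of the transform is controlled by a weighted `L²` norm of `F`. -/
theorem lintegral_fourierInv_rpow_le {F : V → ℂ} (hFm : Measurable F) (hF : Integrable F)
    (hF2 : MemLp F 2) {A : V → ℝ} (hA : Measurable A) (hA0 : ∀ ξ, 0 ≤ A ξ)
    (h : ∀ t, 0 < t → ∫⁻ ξ in {ξ | A ξ ≤ t}, ‖F ξ‖ₑ ≤ ENNReal.ofReal t) {q : ℝ} (hq : 2 < q) :
    ∫⁻ x, ‖𝓕⁻ F x‖ₑ ^ q ≤ ENNReal.ofReal (2 ^ q * (q / (q - 2))) *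
      ∫⁻ ξ, ‖F ξ‖ₑ ^ (2 : ℝ) * ENNReal.ofReal (A ξ ^ (q - 2)) := by
  have hq0 : 0 < q := by linarith
  have hq2 : 0 < q - 2 := by linarith
  have hmeas : Measurable fun p : V × ℝ =>
      (Ioo 0 (A p.1)).indicator (fun t => ENNReal.ofReal (t ^ (q - 2 - 1))) p.2 := by
    have : (fun p : V × ℝ =>
        (Ioo 0 (A p.1)).indicator (fun t => ENNReal.ofReal (t ^ (q - 2 - 1))) p.2) =
        {p : V × ℝ | 0 < p.2 ∧ p.2 < A p.1}.indicator
          (fun p => ENNReal.ofReal (p.2 ^ (q - 2 - 1))) := by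
      ext p
      simp [indicator]
    rw [this]
    refine Measurable.indicator (by fun_prop) ?_
    exact (measurableSet_lt measurable_const measurable_snd).inter
      (measurableSet_lt measurable_snd (hA.comp measurable_fst))
  have h1 := lintegral_rpow_eq_lintegral_meas_lt_mul (volume : Measure V)
    (f := fun x => ‖𝓕⁻ F x‖ / 2) (Eventually.of_forall fun x => by simp; positivity)
    ((continuous_fourierInv hF).norm.div_const 2).aemeasurable hq0
  have h2 : ∫⁻ x, ‖𝓕⁻ F x‖ₑ ^ q =
      ENNReal.ofReal (2 ^ q) * ∫⁻ x : V, ENNReal.ofReal ((‖𝓕⁻ F x‖ / 2) ^ q) := by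
    rw [← lintegral_const_mul' _ _ ENNReal.ofReal_ne_top]
    refine lintegral_congr fun x => ?_
    rw [← ENNReal.ofReal_mul (by positivity), ← Real.mul_rpow (by positivity) (by positivity),
      mul_div_cancel₀ _ two_ne_zero, ← ofReal_norm,
      ENNReal.ofReal_rpow_of_nonneg (norm_nonneg _) hq0.le]
  rw [h2, h1, ENNReal.ofReal_mul (by positivity), mul_assoc]
  refine mul_le_mul_right ?_ _
  have h3 : ∀ ξ, ∫⁻ t, (Ioo 0 (A ξ)).indicator (fun t => ENNReal.ofReal (t ^ (q - 2 - 1))) t =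
      ENNReal.ofReal (A ξ ^ (q - 2) / (q - 2)) := by
    intro ξ
    rw [lintegral_indicator measurableSet_Ioo, lintegral_Ioo_rpow (hA0 ξ) hq2]
  calc ENNReal.ofReal q * ∫⁻ t in Ioi 0, volume {x : V | t < ‖𝓕⁻ F x‖ / 2} *
        ENNReal.ofReal (t ^ (q - 1))
      ≤ ENNReal.ofReal q * ∫⁻ t, ∫⁻ ξ, ‖F ξ‖ₑ ^ (2 : ℝ) *
          (Ioo 0 (A ξ)).indicator (fun t => ENNReal.ofReal (t ^ (q - 2 - 1))) t := by
        refine mul_le_mul_right ?_ _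
        rw [← lintegral_indicator measurableSet_Ioi]
        refine lintegral_mono fun t => ?_
        by_cases ht : t ∈ Ioi (0 : ℝ)
        swap
        · simp [indicator_of_notMem ht]
        rw [indicator_of_mem ht]
        have ht0 : 0 < t := ht
        have h4 := measure_lt_norm_fourierInv_le hF hF2 (measurableSet_le hA measurable_const)
          ht0 (h t ht0)
        refine (mul_le_mul_left h4 _).trans_eq ?_
        have hS : MeasurableSet {ξ | A ξ ≤ t} := measurableSet_le hA measurable_const
        rw [mul_right_comm, ← ENNReal.ofReal_mul (by positivity), ← Real.rpow_add ht0,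
          ← lintegral_indicator hS.compl, ← lintegral_const_mul' _ _ ENNReal.ofReal_ne_top]
        refine lintegral_congr fun ξ => ?_
        by_cases hξ : A ξ ≤ t
        · have : ¬ t < A ξ := not_lt.2 hξ
          simp [indicator, hξ, this]
        · have h5 : t < A ξ := not_le.1 hξ
          simp only [indicator, mem_compl_iff, mem_ofPred_eq, hξ, not_false_eq_true, if_true,
            mem_Ioo, ht0, h5, and_self]
          rw [mul_comm]
          ring_nf
    _ = ENNReal.ofReal q * ∫⁻ ξ, ∫⁻ t, ‖F ξ‖ₑ ^ (2 : ℝ) *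
          (Ioo 0 (A ξ)).indicator (fun t => ENNReal.ofReal (t ^ (q - 2 - 1))) t := by
        rw [lintegral_lintegral_swap]
        refine Measurable.aemeasurable ?_
        refine Measurable.mul ?_ ?_
        · exact (hFm.comp measurable_snd).enorm.pow_const _
        · exact hmeas.comp measurable_swap
    _ = _ := by
        rw [ENNReal.ofReal_div_of_pos hq2, div_eq_mul_inv, mul_assoc]
        congr 1
        rw [← lintegral_const_mul' _ _ (ENNReal.inv_ne_top.2 (by simpa using hq))]
        refine lintegral_congr fun ξ => ?_
        rw [lintegral_const_mul' _ _ (by simp), h3,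
          ENNReal.ofReal_div_of_pos hq2, div_eq_mul_inv]
        ring

theorem lintegral_comp_smul_of_pos (f : V → ℝ≥0∞) {R : ℝ} (hR : 0 < R) :
    ∫⁻ x, f (R • x) = ENNReal.ofReal (R ^ (-(finrank ℝ V : ℝ))) * ∫⁻ x, f x := by
  have h := (Homeomorph.smulOfNeZero R hR.ne').measurableEmbedding.lintegral_map
    (μ := (volume : Measure V)) f
  simp only [Homeomorph.smulOfNeZero_apply] at h
  rw [← h]
  rw [Measure.map_addHaar_smul _ hR.ne', lintegral_smul_measure, smul_eq_mul,
    abs_of_nonneg (by positivity), Real.rpow_neg hR.le, Real.rpow_natCast]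

theorem setLIntegral_norm_rpow_scale {P : ℝ → Prop} (a : ℝ) {R : ℝ} (hR : 0 < R)
    (hP : MeasurableSet {r | P r}) :
    ∫⁻ ξ in {ξ : V | P (‖ξ‖ / R)}, ENNReal.ofReal (‖ξ‖ ^ (-a)) =
      ENNReal.ofReal (R ^ (finrank ℝ V - a)) *
        ∫⁻ ξ in {ξ : V | P ‖ξ‖}, ENNReal.ofReal (‖ξ‖ ^ (-a)) := by
  have hS : MeasurableSet {ξ : V | P ‖ξ‖} := measurable_norm hP
  have hS' : MeasurableSet {ξ : V | P (‖ξ‖ / R)} := (measurable_norm.div_const R) hP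
  have h := lintegral_comp_smul_of_pos
    (fun ξ : V => {ξ : V | P (‖ξ‖ / R)}.indicator (fun ξ => ENNReal.ofReal (‖ξ‖ ^ (-a))) ξ) hR
  rw [← lintegral_indicator hS, ← lintegral_indicator hS']
  have h2 : ∀ ξ : V, {ξ : V | P (‖ξ‖ / R)}.indicator
      (fun ξ => ENNReal.ofReal (‖ξ‖ ^ (-a))) (R • ξ) = ENNReal.ofReal (R ^ (-a)) *
      {ξ : V | P ‖ξ‖}.indicator (fun ξ => ENNReal.ofReal (‖ξ‖ ^ (-a))) ξ := by
    intro ξ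
    have h3 : ‖R • ξ‖ = R * ‖ξ‖ := by rw [norm_smul, Real.norm_of_nonneg hR.le]
    have h4 : ‖R • ξ‖ / R = ‖ξ‖ := by rw [h3, mul_div_cancel_left₀ _ hR.ne']
    by_cases hξ : P ‖ξ‖
    · rw [indicator_of_mem (by simpa [h4] using hξ), indicator_of_mem (by exact hξ), h3,
        ← ENNReal.ofReal_mul (by positivity), Real.mul_rpow hR.le (norm_nonneg _)]
    · rw [indicator_of_notMem (by simpa [h4] using hξ), indicator_of_notMem (by exact hξ), mul_zero]
  simp only [h2] at h
  rw [lintegral_const_mul' _ _ ENNReal.ofReal_ne_top] at h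
  calc _ = ENNReal.ofReal (R ^ (finrank ℝ V : ℝ)) * (ENNReal.ofReal (R ^ (-(finrank ℝ V : ℝ))) *
        ∫⁻ ξ, {ξ : V | P (‖ξ‖ / R)}.indicator (fun ξ => ENNReal.ofReal (‖ξ‖ ^ (-a))) ξ) := by
        rw [← mul_assoc, ← ENNReal.ofReal_mul (by positivity), ← Real.rpow_add hR]
        simp
    _ = _ := by
        rw [← h, ← mul_assoc, ← ENNReal.ofReal_mul (by positivity), ← Real.rpow_add hR]
        rfl

theorem exists_setLIntegral_norm_rpow_le [Nontrivial V] {a : ℝ} (ha : a < finrank ℝ V) :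
    ∃ C : ℝ, 0 < C ∧ ∀ R : ℝ, 0 < R → ∫⁻ ξ in {ξ : V | ‖ξ‖ ≤ R}, ENNReal.ofReal (‖ξ‖ ^ (-a)) ≤
      ENNReal.ofReal (C * R ^ (finrank ℝ V - a)) := by
  have hfin : ∫⁻ ξ in {ξ : V | ‖ξ‖ ≤ 1}, ENNReal.ofReal (‖ξ‖ ^ (-a)) ≠ ∞ := by
    have h := integrableOn_ball_of_norm_le_rpow (μ := (volume : Measure V))
      (f := fun ξ : V => ‖ξ‖ ^ (-a)) (C := 1) (r := 2) finrank_pos ha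
      (Eventually.of_forall fun x => by
        rw [one_mul, Real.norm_of_nonneg (by positivity)])
      (measurable_norm.pow_const _).aestronglyMeasurable
    have h2 : IntegrableOn (fun ξ : V => ‖ξ‖ ^ (-a)) {ξ : V | ‖ξ‖ ≤ 1} :=
      h.mono_set fun x hx => by
        simp only [mem_ofPred_eq, mem_ball_zero_iff] at hx ⊢
        linarith
    exact h2.lintegral_lt_top.ne
  refine ⟨(∫⁻ ξ in {ξ : V | ‖ξ‖ ≤ 1}, ENNReal.ofReal (‖ξ‖ ^ (-a))).toReal + 1, by positivity,
    fun R hR => ?_⟩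
  have h := setLIntegral_norm_rpow_scale (V := V) (P := fun r => r ≤ 1) a hR measurableSet_Iic
  simp only [div_le_one hR] at h
  rw [h, mul_comm, ENNReal.ofReal_mul (by positivity)]
  gcongr
  rw [ENNReal.le_ofReal_iff_toReal_le hfin (by positivity)]
  linarith

theorem exists_setLIntegral_norm_rpow_le_of_gt {a : ℝ} (ha : finrank ℝ V < a) :
    ∃ C : ℝ, 0 < C ∧ ∀ R : ℝ, 0 < R → ∫⁻ ξ in {ξ : V | R ≤ ‖ξ‖}, ENNReal.ofReal (‖ξ‖ ^ (-a)) ≤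
      ENNReal.ofReal (C * R ^ (finrank ℝ V - a)) := by
  have ha0 : 0 < a := (Nat.cast_nonneg _).trans_lt ha
  have hfin : ∫⁻ ξ in {ξ : V | 1 ≤ ‖ξ‖}, ENNReal.ofReal (‖ξ‖ ^ (-a)) ≠ ∞ := by
    refine ne_top_of_le_ne_top (b := ENNReal.ofReal (2 ^ a) *
      ∫⁻ ξ : V, ENNReal.ofReal ((1 + ‖ξ‖) ^ (-a)))
      (ENNReal.mul_ne_top (by simp) (finite_integral_one_add_norm (μ := volume) ha).ne) ?_
    rw [← lintegral_const_mul' _ _ ENNReal.ofReal_ne_top,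
      ← lintegral_indicator (measurableSet_le measurable_const measurable_norm)]
    refine lintegral_mono fun ξ => ?_
    simp only [indicator, mem_ofPred_eq]
    split_ifs with hξ
    · rw [← ENNReal.ofReal_mul (by positivity)]
      apply ENNReal.ofReal_le_ofReal
      have h0 : 0 < ‖ξ‖ := by linarith
      rw [Real.rpow_neg h0.le, Real.rpow_neg (by positivity), ← div_eq_mul_inv,
        ← Real.div_rpow (by positivity) (by positivity), ← Real.inv_rpow h0.le]
      gcongr
      rw [inv_eq_one_div, div_le_div_iff₀ h0 (by positivity)]
      linarith
    · simp
  refine ⟨(∫⁻ ξ in {ξ : V | 1 ≤ ‖ξ‖}, ENNReal.ofReal (‖ξ‖ ^ (-a))).toReal + 1, by positivity,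
    fun R hR => ?_⟩
  have h := setLIntegral_norm_rpow_scale (V := V) (P := fun r => 1 ≤ r) a hR measurableSet_Ici
  simp only [one_le_div hR] at h
  rw [h, mul_comm, ENNReal.ofReal_mul (by positivity)]
  gcongr
  rw [ENNReal.le_ofReal_iff_toReal_le hfin (by positivity)]
  linarith

/-- The weighted `p`-th moment of `F`. -/
noncomputable def weightedMoment (β p : ℝ) (F : V → ℂ) (S : Set V) : ℝ≥0∞ :=
  ∫⁻ ξ in S, ENNReal.ofReal (‖ξ‖ ^ (β * p)) * ‖F ξ‖ₑ ^ p

theorem exists_setLIntegral_enorm_le [Nontrivial V] {β p : ℝ} (hp : 1 < p)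
    (hβ : β < finrank ℝ V * (1 - 1 / p)) :
    ∃ C : ℝ, 0 < C ∧ ∀ F : V → ℂ, Measurable F → ∀ R : ℝ, 0 < R →
      ∫⁻ ξ in {ξ : V | ‖ξ‖ ≤ R}, ‖F ξ‖ₑ ≤
        ENNReal.ofReal (C * R ^ (finrank ℝ V * (1 - 1 / p) - β)) *
          weightedMoment β p F {ξ : V | ‖ξ‖ ≤ R} ^ (1 / p) := by
  have hp0 : 0 < p := by linarith
  have hpq : p.HolderConjugate (p / (p - 1)) := Real.HolderConjugate.conjExponent hp
  set p' := p / (p - 1) with hp'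
  have hp'0 : 0 < p' := hpq.symm.pos
  have hinv : 1 / p' = 1 - 1 / p := by rw [hp']; field_simp
  have hβ' : β * p' < finrank ℝ V := by
    rw [← hinv] at hβ
    calc β * p' < finrank ℝ V * (1 / p') * p' := by gcongr
      _ = _ := by field_simp
  obtain ⟨C, hC, h⟩ := exists_setLIntegral_norm_rpow_le (V := V) hβ'
  refine ⟨C ^ (1 / p'), by positivity, fun F hF R hR => ?_⟩
  have key := ENNReal.lintegral_mul_le_Lp_mul_Lq (volume.restrict {ξ : V | ‖ξ‖ ≤ R}) hpq.symm
    (f := fun ξ => ENNReal.ofReal (‖ξ‖ ^ (-β))) (g := fun ξ => ENNReal.ofReal (‖ξ‖ ^ β) * ‖F ξ‖ₑ)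
    (by fun_prop) (by fun_prop)
  have h1 : ∫⁻ ξ in {ξ : V | ‖ξ‖ ≤ R}, ‖F ξ‖ₑ = ∫⁻ ξ in {ξ : V | ‖ξ‖ ≤ R},
      ((fun ξ : V => ENNReal.ofReal (‖ξ‖ ^ (-β))) *
        (fun ξ : V => ENNReal.ofReal (‖ξ‖ ^ β) * ‖F ξ‖ₑ) : V → ℝ≥0∞) ξ := by
    refine lintegral_congr_ae (ae_restrict_of_ae ?_)
    filter_upwards [(measure_singleton (0 : V) : volume {(0 : V)} = 0) |> compl_mem_ae_iff.2]
      with ξ hξ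
    have hξ0 : 0 < ‖ξ‖ := norm_pos_iff.2 hξ
    rw [Pi.mul_apply, ← mul_assoc, ← ENNReal.ofReal_mul (by positivity), ← Real.rpow_add hξ0]
    simp
  rw [h1]
  refine key.trans ?_
  have h2 : ∀ ξ : V, ENNReal.ofReal (‖ξ‖ ^ (-β)) ^ p' = ENNReal.ofReal (‖ξ‖ ^ (-(β * p'))) := by
    intro ξ
    rw [ENNReal.ofReal_rpow_of_nonneg (by positivity) hp'0.le, ← Real.rpow_mul (norm_nonneg _),
      neg_mul]
  have h3 : ∀ ξ : V, (ENNReal.ofReal (‖ξ‖ ^ β) * ‖F ξ‖ₑ) ^ p =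
      ENNReal.ofReal (‖ξ‖ ^ (β * p)) * ‖F ξ‖ₑ ^ p := by
    intro ξ
    rw [ENNReal.mul_rpow_of_nonneg _ _ hp0.le, ENNReal.ofReal_rpow_of_nonneg (by positivity) hp0.le,
      ← Real.rpow_mul (norm_nonneg _)]
  simp only [h2, h3]
  refine mul_le_mul' ((ENNReal.rpow_le_rpow (h R hR) (by positivity)).trans_eq ?_) le_rfl
  rw [ENNReal.ofReal_rpow_of_nonneg (by positivity) (by positivity), Real.mul_rpow hC.le
    (by positivity), ← Real.rpow_mul hR.le]
  congr 3
  rw [sub_mul, hinv]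
  have : β * p' * (1 - 1 / p) = β := by rw [← hinv]; field_simp
  rw [this]

theorem le_of_weight_mul_rpow_le {x r R v b p : ℝ} (hx : 0 < x) (hR : 0 < R) (hr : R ≤ r)
    (hb : 0 ≤ b) (hp : 1 < p) (hp2 : p < 2) (h : r ^ b * x ^ (p - 2) ≤ v) :
    x ≤ v ^ ((p - 1) / (2 - p)) * R ^ (-b / (2 - p)) * (r ^ b * x ^ p) := by
  have hr0 : 0 < r := hR.trans_le hr
  have h2p : 0 < 2 - p := by linarith
  have hθ : 0 ≤ (p - 1) / (2 - p) := div_nonneg (by linarith) h2p.le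
  have hv : 0 ≤ v := le_trans (by positivity) h
  have h1 : (r ^ b * x ^ (p - 2)) ^ ((p - 1) / (2 - p)) ≤ v ^ ((p - 1) / (2 - p)) := by gcongr
  have h2 : (r ^ b * x ^ (p - 2)) ^ ((p - 1) / (2 - p)) * r ^ (-b / (2 - p)) * (r ^ b * x ^ p) = x := by
    rw [Real.mul_rpow (by positivity) (by positivity), ← Real.rpow_mul hr0.le, ← Real.rpow_mul hx.le]
    calc _ = (r ^ (b * ((p - 1) / (2 - p))) * r ^ (-b / (2 - p)) * r ^ b) *
          (x ^ ((p - 2) * ((p - 1) / (2 - p))) * x ^ p) := by ring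
      _ = r ^ (b * ((p - 1) / (2 - p)) + -b / (2 - p) + b) *
          x ^ ((p - 2) * ((p - 1) / (2 - p)) + p) := by
        rw [Real.rpow_add hr0, Real.rpow_add hr0, Real.rpow_add hx]
      _ = r ^ (0 : ℝ) * x ^ (1 : ℝ) := by
        congr 2 <;> field_simp <;> ring
      _ = x := by simp
  have h3 : r ^ (-b / (2 - p)) ≤ R ^ (-b / (2 - p)) := by
    refine Real.rpow_le_rpow_of_nonpos hR hr ?_
    rw [neg_div]
    exact neg_nonpos.2 (div_nonneg hb h2p.le)
  calc x = _ := h2.symm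
    _ ≤ _ := by gcongr

theorem weightedMoment_mono {β p : ℝ} (F : V → ℂ) {S T : Set V} (h : S ⊆ T) :
    weightedMoment β p F S ≤ weightedMoment β p F T :=
  lintegral_mono_set h

theorem exists_lintegral_fourierInv_rpow_le_of_lt_two [Nontrivial V] {β p q : ℝ} (hp : 1 < p)
    (hp2 : p < 2) (hq : 2 < q) (hβ : 0 < β) (hβe : β = finrank ℝ V * (1 - 1 / p - 1 / q)) :
    ∃ C : ℝ, 0 < C ∧ ∀ F : V → ℂ, Measurable F → Integrable F → MemLp F 2 →
      weightedMoment β p F univ ≤ 1 → ∫⁻ x, ‖𝓕⁻ F x‖ₑ ^ q ≤ ENNReal.ofReal C := by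
  have hp0 : 0 < p := by linarith
  have hq0 : 0 < q := by linarith
  have h2p : 0 < 2 - p := by linarith
  have hq2 : 0 < q - 2 := by linarith
  have hn : (0 : ℝ) < finrank ℝ V := by exact_mod_cast finrank_pos
  set n : ℝ := (finrank ℝ V : ℝ) with hn_def
  have hexp : n * (1 - 1 / p) - β = n / q := by rw [hβe]; ring
  obtain ⟨C₁, hC₁, hlow⟩ := exists_setLIntegral_enorm_le (V := V) (β := β) hp (by
    rw [← hn_def]; have : 0 < n / q := by positivity
    linarith)
  simp only [← hn_def, hexp] at hlow
  set θ := (p - 1) / (2 - p) with hθ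
  have hθ0 : 0 < θ := div_pos (by linarith) h2p
  set e := q / n * (β * p / (2 - p)) with he
  set K := (2 * (2 * C₁) ^ e) ^ (1 / ((q - 2) * θ)) with hK
  have hK0 : 0 < K := by positivity
  have hKe : K ^ (-((q - 2) * θ)) * (2 * C₁) ^ e = 1 / 2 := by
    rw [hK, ← Real.rpow_mul (by positivity)]
    have : 1 / ((q - 2) * θ) * -((q - 2) * θ) = -1 := by field_simp
    rw [this, Real.rpow_neg_one]
    field_simp
  clear_value K
  refine ⟨2 ^ q * (q / (q - 2)) * K ^ (q - 2), by positivity, fun F hFm hF hF2 hH => ?_⟩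
  set A : V → ℝ := fun ξ => K * (‖ξ‖ ^ (β * p) * ‖F ξ‖ ^ (p - 2)) ^ (1 / (q - 2)) with hA
  have hAm : Measurable A := by
    refine Measurable.const_mul (Measurable.pow_const ?_ _) _
    exact (measurable_norm.pow_const _).mul (hFm.norm.pow_const _)
  have hA0 : ∀ ξ, 0 ≤ A ξ := fun ξ => by positivity
  have hcond : ∀ t, 0 < t → ∫⁻ ξ in {ξ | A ξ ≤ t}, ‖F ξ‖ₑ ≤ ENNReal.ofReal t := by
    intro t ht
    set R := (t / (2 * C₁)) ^ (q / n) with hR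
    have hR0 : 0 < R := by positivity
    have hRe : C₁ * R ^ (n / q) = t / 2 := by
      rw [hR, ← Real.rpow_mul (by positivity)]
      have : q / n * (n / q) = 1 := by field_simp
      rw [this, Real.rpow_one]; field_simp
    have hB : MeasurableSet {ξ : V | ‖ξ‖ ≤ R} := measurableSet_le measurable_norm measurable_const
    have hconst : ((t / K) ^ (q - 2)) ^ θ * R ^ (-(β * p) / (2 - p)) = t / 2 := by
      rw [hR, ← Real.rpow_mul (by positivity), ← Real.rpow_mul (by positivity)]
      have e1 : q / n * (-(β * p) / (2 - p)) = -e := by rw [he]; ring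
      rw [e1, Real.div_rpow ht.le hK0.le, Real.div_rpow ht.le (by positivity),
        Real.rpow_neg (by positivity) (x := 2 * C₁), Real.rpow_neg ht.le]
      rw [Real.rpow_neg hK0.le] at hKe
      have e2 : t ^ ((q - 2) * θ) = t * t ^ e := by
        rw [← Real.rpow_one_add' ht.le]
        · congr 1
          rw [hθ, he, hβe]
          field_simp
          ring
        · rw [he]; positivity
      rw [e2]
      have h3 : 0 < t ^ e := by positivity
      have h4 : 0 < K ^ ((q - 2) * θ) := by positivity
      have h5 : 0 < (2 * C₁) ^ e := by positivity
      field_simp at hKe ⊢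
      linarith
    have hhigh : ∫⁻ ξ in {ξ | A ξ ≤ t} \ {ξ | ‖ξ‖ ≤ R}, ‖F ξ‖ₑ ≤ ENNReal.ofReal (t / 2) := by
      calc ∫⁻ ξ in {ξ | A ξ ≤ t} \ {ξ | ‖ξ‖ ≤ R}, ‖F ξ‖ₑ
          ≤ ∫⁻ ξ in {ξ | A ξ ≤ t} \ {ξ | ‖ξ‖ ≤ R}, ENNReal.ofReal (t / 2) *
              (ENNReal.ofReal (‖ξ‖ ^ (β * p)) * ‖F ξ‖ₑ ^ p) := by
            refine setLIntegral_mono' ((measurableSet_le hAm measurable_const).diff hB) ?_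
            intro ξ hξ
            have hξ1 : A ξ ≤ t := hξ.1
            have hξ2 : R ≤ ‖ξ‖ := le_of_lt (not_le.1 hξ.2)
            rcases eq_or_ne (F ξ) 0 with h0 | h0
            · simp [h0]
            have hx : 0 < ‖F ξ‖ := norm_pos_iff.2 h0
            have hv : ‖ξ‖ ^ (β * p) * ‖F ξ‖ ^ (p - 2) ≤ (t / K) ^ (q - 2) := by
              have : (‖ξ‖ ^ (β * p) * ‖F ξ‖ ^ (p - 2)) ^ (1 / (q - 2)) ≤ t / K := by
                rw [le_div_iff₀ hK0, mul_comm]; exact hξ1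
              calc _ = ((‖ξ‖ ^ (β * p) * ‖F ξ‖ ^ (p - 2)) ^ (1 / (q - 2))) ^ (q - 2) := by
                    rw [← Real.rpow_mul (by positivity), one_div_mul_cancel hq2.ne', Real.rpow_one]
                _ ≤ _ := by gcongr
            have := le_of_weight_mul_rpow_le hx hR0 hξ2 (by positivity) hp hp2 hv
            rw [hconst] at this
            rw [← ofReal_norm, ENNReal.ofReal_rpow_of_pos hx, ← ENNReal.ofReal_mul (by positivity),
              ← ENNReal.ofReal_mul (by positivity)]
            exact ENNReal.ofReal_le_ofReal this
        _ ≤ ENNReal.ofReal (t / 2) * 1 := by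
            rw [lintegral_const_mul' _ _ ENNReal.ofReal_ne_top]
            gcongr
            exact (weightedMoment_mono F (subset_univ _)).trans hH
        _ = _ := mul_one _
    calc ∫⁻ ξ in {ξ | A ξ ≤ t}, ‖F ξ‖ₑ
        ≤ ∫⁻ ξ in {ξ | ‖ξ‖ ≤ R} ∪ ({ξ | A ξ ≤ t} \ {ξ | ‖ξ‖ ≤ R}), ‖F ξ‖ₑ :=
          lintegral_mono_set (by rw [union_sdiff_self]; exact subset_union_right)
      _ ≤ ENNReal.ofReal (t / 2) + ENNReal.ofReal (t / 2) := by
          refine (lintegral_union_le _ _ _).trans (add_le_add ?_ hhigh)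
          refine (hlow F hFm R hR0).trans ?_
          rw [hRe]
          refine mul_le_of_le_one_right' (ENNReal.rpow_le_one ?_ (by positivity))
          exact (weightedMoment_mono F (subset_univ _)).trans hH
      _ = ENNReal.ofReal t := by
          rw [← ENNReal.ofReal_add (by positivity) (by positivity), add_halves]
  refine (lintegral_fourierInv_rpow_le hFm hF hF2 hAm hA0 hcond hq).trans ?_
  rw [ENNReal.ofReal_mul (by positivity) (p := 2 ^ q * (q / (q - 2)))]
  gcongr
  calc ∫⁻ ξ, ‖F ξ‖ₑ ^ (2 : ℝ) * ENNReal.ofReal (A ξ ^ (q - 2))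
      = ENNReal.ofReal (K ^ (q - 2)) * weightedMoment β p F univ := by
        rw [weightedMoment, Measure.restrict_univ, ← lintegral_const_mul' _ _ ENNReal.ofReal_ne_top]
        refine lintegral_congr fun ξ => ?_
        rcases eq_or_ne (F ξ) 0 with h0 | h0
        · simp [h0, hp0]
        have hx : 0 < ‖F ξ‖ := norm_pos_iff.2 h0
        rw [← ofReal_norm, ENNReal.ofReal_rpow_of_pos hx, ENNReal.ofReal_rpow_of_pos hx,
          ← ENNReal.ofReal_mul (by positivity), ← ENNReal.ofReal_mul (by positivity),
          ← ENNReal.ofReal_mul (by positivity)]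
        congr 1
        rw [hA, Real.mul_rpow hK0.le (by positivity), ← Real.rpow_mul (by positivity),
          one_div_mul_cancel hq2.ne', Real.rpow_one, Real.rpow_sub hx]
        field_simp
    _ ≤ ENNReal.ofReal (K ^ (q - 2)) * 1 := by gcongr
    _ = _ := mul_one _

theorem measure_setOf_measure_Iic_le (ν : Measure ℝ) (t : ℝ≥0∞) :
    ν {R | ν (Iic R) ≤ t} ≤ t := by
  set T := {R | ν (Iic R) ≤ t} with hT
  have hlower : ∀ {x y}, y ∈ T → x ≤ y → x ∈ T := fun hy hxy =>
    (measure_mono (Iic_subset_Iic.2 hxy)).trans hy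
  by_cases hmax : ∃ s ∈ T, ∀ x ∈ T, x ≤ s
  · obtain ⟨s, hs, hsm⟩ := hmax
    exact (measure_mono fun x hx => hsm x hx).trans hs
  push Not at hmax
  have hcover : T ⊆ ⋃ r ∈ {r : ℚ | (r : ℝ) ∈ T}, Iic (r : ℝ) := by
    intro x hx
    obtain ⟨y, hy, hxy⟩ := hmax x hx
    obtain ⟨r, hxr, hry⟩ := exists_rat_btwn hxy
    exact mem_biUnion (show r ∈ {r : ℚ | (r : ℝ) ∈ T} from hlower hy hry.le) hxr.le
  refine (measure_mono hcover).trans ?_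
  rw [measure_biUnion_eq_iSup (to_countable _)]
  · exact iSup₂_le fun r hr => hr
  · intro a ha b hb
    rcases le_total a b with h | h
    · exact ⟨b, hb, Iic_subset_Iic.2 (by exact_mod_cast h), subset_rfl⟩
    · exact ⟨a, ha, subset_rfl, Iic_subset_Iic.2 (by exact_mod_cast h)⟩

theorem ae_norm_pos [Nontrivial V] : ∀ᵐ ξ : V, 0 < ‖ξ‖ := by
  filter_upwards [compl_mem_ae_iff.2 (measure_singleton (0 : V) : volume {(0 : V)} = 0)] with ξ hξ
  exact norm_pos_iff.2 hξ

/-- A weighted Hardy inequality for the mass function `R ↦ ∫_{‖η‖ ≤ R} ‖F η‖`. -/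
theorem exists_lintegral_ball_mass_rpow_le [Nontrivial V] {β p γ : ℝ} (hp : 1 < p)
    (hγ : 0 < γ) (hβ : β = finrank ℝ V * (1 - 1 / p) - γ) :
    ∃ C : ℝ, 0 < C ∧ ∀ F : V → ℂ, Measurable F →
      ∫⁻ ξ : V, ENNReal.ofReal (‖ξ‖ ^ (-(finrank ℝ V + γ * p))) *
        (∫⁻ η in {η : V | ‖η‖ ≤ ‖ξ‖}, ‖F η‖ₑ) ^ p ≤
      ENNReal.ofReal C * weightedMoment β p F univ := by
  have hp0 : 0 < p := by linarith
  set n : ℝ := (finrank ℝ V : ℝ) with hn_def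
  have hexp : n * (1 - 1 / p) - (β + γ / 2) = γ / 2 := by rw [hβ]; ring
  obtain ⟨C₁, hC₁, h₁⟩ := exists_setLIntegral_enorm_le (V := V) (β := β + γ / 2) hp (by
    rw [← hn_def]; linarith)
  simp only [← hn_def, hexp] at h₁
  have hgt : finrank ℝ V < n + γ / 2 * p := by
    rw [← hn_def]
    have : 0 < γ / 2 * p := by positivity
    linarith
  obtain ⟨C₂, hC₂, h₂⟩ := exists_setLIntegral_norm_rpow_le_of_gt (V := V) hgt
  rw [← hn_def, sub_add_cancel_left] at h₂
  refine ⟨C₁ ^ p * C₂, by positivity, fun F hF => ?_⟩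
  set w : V → ℝ≥0∞ := fun η => ENNReal.ofReal (‖η‖ ^ ((β + γ / 2) * p)) * ‖F η‖ₑ ^ p with hw
  have hwm : Measurable w := by
    refine Measurable.mul (Measurable.ennreal_ofReal (measurable_norm.pow_const _)) ?_
    exact hF.enorm.pow_const _
  have hset : MeasurableSet {z : V × V | ‖z.2‖ ≤ ‖z.1‖} := measurableSet_le (by fun_prop) (by fun_prop)
  calc _ ≤ ∫⁻ ξ : V, ENNReal.ofReal (C₁ ^ p) * ∫⁻ η, {z : V × V | ‖z.2‖ ≤ ‖z.1‖}.indicator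
          (fun z => ENNReal.ofReal (‖z.1‖ ^ (-(n + γ / 2 * p))) * w z.2) (ξ, η) := by
        refine lintegral_mono_ae ?_
        filter_upwards [ae_norm_pos (V := V)] with ξ hξ
        have h3 := ENNReal.rpow_le_rpow (h₁ F hF ‖ξ‖ hξ) hp0.le
        rw [ENNReal.mul_rpow_of_nonneg _ _ hp0.le, ← ENNReal.rpow_mul, one_div_mul_cancel hp0.ne',
          ENNReal.rpow_one, ENNReal.ofReal_rpow_of_nonneg (by positivity) hp0.le,
          Real.mul_rpow hC₁.le (by positivity), ← Real.rpow_mul hξ.le] at h3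
        refine (mul_le_mul_right h3 _).trans_eq ?_
        have h4 : ∫⁻ η, {z : V × V | ‖z.2‖ ≤ ‖z.1‖}.indicator
            (fun z => ENNReal.ofReal (‖z.1‖ ^ (-(n + γ / 2 * p))) * w z.2) (ξ, η) =
            ENNReal.ofReal (‖ξ‖ ^ (-(n + γ / 2 * p))) * weightedMoment (β + γ / 2) p F
              {η | ‖η‖ ≤ ‖ξ‖} := by
          rw [weightedMoment, ← lintegral_const_mul' _ _ ENNReal.ofReal_ne_top,
            ← lintegral_indicator (measurableSet_le measurable_norm measurable_const)]
          rfl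
        rw [h4, ← mul_assoc, ← mul_assoc, ← ENNReal.ofReal_mul (by positivity),
          ← ENNReal.ofReal_mul (by positivity)]
        congr 2
        rw [mul_comm, mul_assoc, ← Real.rpow_add hξ]
        congr 2
        ring
    _ = ENNReal.ofReal (C₁ ^ p) * ∫⁻ η, ∫⁻ ξ, {z : V × V | ‖z.2‖ ≤ ‖z.1‖}.indicator
          (fun z => ENNReal.ofReal (‖z.1‖ ^ (-(n + γ / 2 * p))) * w z.2) (ξ, η) := by
        rw [lintegral_const_mul' _ _ ENNReal.ofReal_ne_top, lintegral_lintegral_swap]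
        refine Measurable.aemeasurable (Measurable.indicator ?_ hset)
        exact (Measurable.ennreal_ofReal (measurable_fst.norm.pow_const _)).mul
          (hwm.comp measurable_snd)
    _ ≤ ENNReal.ofReal (C₁ ^ p) * ∫⁻ η, ENNReal.ofReal C₂ *
          (ENNReal.ofReal (‖η‖ ^ (β * p)) * ‖F η‖ₑ ^ p) := by
        refine mul_le_mul_right (lintegral_mono_ae ?_) _
        filter_upwards [ae_norm_pos (V := V)] with η hη
        have h5 : ∫⁻ ξ, {z : V × V | ‖z.2‖ ≤ ‖z.1‖}.indicator
            (fun z => ENNReal.ofReal (‖z.1‖ ^ (-(n + γ / 2 * p))) * w z.2) (ξ, η) =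
            (∫⁻ ξ in {ξ : V | ‖η‖ ≤ ‖ξ‖}, ENNReal.ofReal (‖ξ‖ ^ (-(n + γ / 2 * p)))) * w η := by
          rw [← lintegral_mul_const _ (Measurable.ennreal_ofReal (measurable_norm.pow_const _)),
            ← lintegral_indicator (measurableSet_le measurable_const measurable_norm)]
          rfl
        rw [h5]
        refine (mul_le_mul_left (h₂ _ hη) _).trans_eq ?_
        rw [hw]
        dsimp only
        rw [← mul_assoc, ← mul_assoc, ← ENNReal.ofReal_mul (by positivity),
          ← ENNReal.ofReal_mul (by positivity), mul_assoc C₂, ← Real.rpow_add hη]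
        congr 4
        ring
    _ = _ := by
        rw [lintegral_const_mul' _ _ ENNReal.ofReal_ne_top, ← mul_assoc,
          ← ENNReal.ofReal_mul (by positivity), weightedMoment, Measure.restrict_univ]

theorem exists_lintegral_fourierInv_rpow_le_of_two_le [Nontrivial V] {β p q : ℝ} (hp : 2 ≤ p)
    (hpq : p ≤ q) (hq : 2 < q) (hβe : β = finrank ℝ V * (1 - 1 / p - 1 / q)) :
    ∃ C : ℝ, 0 < C ∧ ∀ F : V → ℂ, Measurable F → Integrable F → MemLp F 2 →
      weightedMoment β p F univ ≤ 1 → ∫⁻ x, ‖𝓕⁻ F x‖ₑ ^ q ≤ ENNReal.ofReal C := by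
  have hp0 : 0 < p := by linarith
  have hq0 : 0 < q := by linarith
  have hq2 : 0 < q - 2 := by linarith
  have hn : (0 : ℝ) < finrank ℝ V := by exact_mod_cast finrank_pos
  set n : ℝ := (finrank ℝ V : ℝ) with hn_def
  have hexp : n * (1 - 1 / p) - β = n / q := by rw [hβe]; ring
  have hnq : 0 < n / q := by positivity
  obtain ⟨C₁, hC₁, h₁⟩ := exists_setLIntegral_enorm_le (V := V) (β := β) (p := p) (by linarith) (by
    rw [← hn_def]; linarith)
  simp only [← hn_def, hexp] at h₁
  obtain ⟨C₂, hC₂, h₂⟩ := exists_lintegral_ball_mass_rpow_le (V := V) (β := β) (p := p)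
    (by linarith) hnq (by rw [← hn_def]; linarith)
  rw [← hn_def] at h₂
  refine ⟨2 ^ q * (q / (q - 2)) * (C₁ ^ (q - p) * (1 + C₂)), by positivity,
    fun F hFm hF hF2 hH => ?_⟩
  set ν : Measure ℝ := (volume.withDensity fun ξ => ‖F ξ‖ₑ).map (fun ξ : V => ‖ξ‖) with hν
  have hνS : ∀ S : Set ℝ, MeasurableSet S → ν S = ∫⁻ ξ in {ξ : V | ‖ξ‖ ∈ S}, ‖F ξ‖ₑ := by
    intro S hS
    rw [hν, Measure.map_apply measurable_norm hS, withDensity_apply _ (measurable_norm hS)]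
    rfl
  have hνfin : ∀ S, ν S ≠ ∞ := fun S => by
    refine ne_top_of_le_ne_top ?_ (measure_mono (subset_univ S))
    rw [hνS _ MeasurableSet.univ]
    simpa using hF.hasFiniteIntegral.ne
  set M : ℝ → ℝ := fun R => (ν (Iic R)).toReal with hM
  have hMmono : Monotone M := fun a b hab =>
    ENNReal.toReal_mono (hνfin _) (measure_mono (Iic_subset_Iic.2 hab))
  have hM0 : ∀ R, 0 ≤ M R := fun R => ENNReal.toReal_nonneg
  have hMball : ∀ R, ENNReal.ofReal (M R) = ∫⁻ ξ in {ξ : V | ‖ξ‖ ≤ R}, ‖F ξ‖ₑ := by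
    intro R
    rw [hM, ENNReal.ofReal_toReal (hνfin _), hνS _ measurableSet_Iic]
    rfl
  have hMle : ∀ R, 0 < R → M R ≤ C₁ * R ^ (n / q) := by
    intro R hR
    have h3 : ENNReal.ofReal (M R) ≤ ENNReal.ofReal (C₁ * R ^ (n / q)) := by
      rw [hMball]
      refine (h₁ F hFm R hR).trans (mul_le_of_le_one_right' (ENNReal.rpow_le_one ?_ (by positivity)))
      exact (weightedMoment_mono F (subset_univ _)).trans hH
    exact (ENNReal.ofReal_le_ofReal_iff (by positivity)).1 h3
  have hAm : Measurable fun ξ : V => M ‖ξ‖ := hMmono.measurable.comp measurable_norm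
  have hcond : ∀ t, 0 < t → ∫⁻ ξ in {ξ : V | M ‖ξ‖ ≤ t}, ‖F ξ‖ₑ ≤ ENNReal.ofReal t := by
    intro t ht
    have h4 := measure_setOf_measure_Iic_le ν (ENNReal.ofReal t)
    have h5 : {R | ν (Iic R) ≤ ENNReal.ofReal t} = {R | M R ≤ t} := by
      ext R
      exact ENNReal.le_ofReal_iff_toReal_le (hνfin _) ht.le
    rwa [h5, hνS _ (measurableSet_le hMmono.measurable measurable_const)] at h4
  refine (lintegral_fourierInv_rpow_le hFm hF hF2 hAm (fun ξ => hM0 _) hcond hq).trans ?_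
  rw [ENNReal.ofReal_mul (by positivity) (p := 2 ^ q * (q / (q - 2)))]
  gcongr
  calc ∫⁻ ξ, ‖F ξ‖ₑ ^ (2 : ℝ) * ENNReal.ofReal (M ‖ξ‖ ^ (q - 2))
      ≤ ∫⁻ ξ : V, ENNReal.ofReal (C₁ ^ (q - p)) *
          (ENNReal.ofReal (‖ξ‖ ^ (β * p)) * ‖F ξ‖ₑ ^ p +
          ENNReal.ofReal (‖ξ‖ ^ (-(n + n / q * p))) * ENNReal.ofReal (M ‖ξ‖) ^ p) := by
        refine lintegral_mono_ae ?_
        filter_upwards [ae_norm_pos (V := V)] with ξ hξ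
        set r := ‖ξ‖
        set m := M r with hm
        have hm0 : 0 ≤ m := hM0 _
        set x := ‖F ξ‖ with hx
        have hx0 : 0 ≤ x := norm_nonneg _
        have hmle := hMle r hξ
        rw [← hm] at hmle
        set h := r ^ β * x with hh
        have hh0 : 0 ≤ h := by positivity
        set N := r ^ (-(n / p + n / q)) * m with hN
        have hN0 : 0 ≤ N := by positivity
        have e1 : m ^ (q - 2) ≤ C₁ ^ (q - p) * r ^ (n / q * (q - p)) * m ^ (p - 2) := by
          have : m ^ (q - 2) = m ^ (q - p) * m ^ (p - 2) := by
            rw [← Real.rpow_add_of_nonneg hm0 (by linarith) (by linarith)]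
            ring_nf
          rw [this]
          gcongr
          calc m ^ (q - p) ≤ (C₁ * r ^ (n / q)) ^ (q - p) := by
                exact Real.rpow_le_rpow hm0 hmle (by linarith)
            _ = _ := by rw [Real.mul_rpow hC₁.le (by positivity), ← Real.rpow_mul hξ.le]
        have e2 : x ^ (2 : ℝ) * (r ^ (n / q * (q - p)) * m ^ (p - 2)) =
            h ^ (2 : ℝ) * N ^ (p - 2) := by
          rw [hh, hN, Real.mul_rpow (by positivity) hx0, Real.mul_rpow (by positivity) hm0,
            ← Real.rpow_mul hξ.le, ← Real.rpow_mul hξ.le]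
          have : r ^ (n / q * (q - p)) = r ^ (β * 2) * r ^ (-(n / p + n / q) * (p - 2)) := by
            rw [← Real.rpow_add hξ]
            congr 1
            rw [hβe]
            field_simp
            ring
          rw [this]
          ring
        have e3 : h ^ (2 : ℝ) * N ^ (p - 2) ≤ h ^ p + N ^ p := by
          set z := max h N with hz
          have hz0 : 0 ≤ z := le_max_of_le_left hh0
          calc h ^ (2 : ℝ) * N ^ (p - 2) ≤ z ^ (2 : ℝ) * z ^ (p - 2) := by
                gcongr
                · exact le_max_left _ _
                · exact le_max_right _ _
            _ = z ^ p := by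
                rw [← Real.rpow_add_of_nonneg hz0 (by norm_num) (by linarith)]
                ring_nf
            _ ≤ _ := by
                have := Real.rpow_nonneg hh0 p
                have := Real.rpow_nonneg hN0 p
                rcases max_choice h N with h6 | h6 <;> rw [hz, h6] <;> linarith
        have e4 : h ^ p = r ^ (β * p) * x ^ p := by
          rw [hh, Real.mul_rpow (by positivity) hx0, ← Real.rpow_mul hξ.le]
        have e5 : N ^ p = r ^ (-(n + n / q * p)) * m ^ p := by
          rw [hN, Real.mul_rpow (by positivity) hm0, ← Real.rpow_mul hξ.le]
          congr 2
          field_simp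
        rw [← ofReal_norm, ENNReal.ofReal_rpow_of_nonneg hx0 (by norm_num),
          ENNReal.ofReal_rpow_of_nonneg hx0 hp0.le, ENNReal.ofReal_rpow_of_nonneg hm0 hp0.le,
          ← ENNReal.ofReal_mul (by positivity), ← ENNReal.ofReal_mul (by positivity),
          ← ENNReal.ofReal_mul (by positivity), ← ENNReal.ofReal_add (by positivity)
          (by positivity), ← ENNReal.ofReal_mul (by positivity), ← e4, ← e5]
        apply ENNReal.ofReal_le_ofReal
        calc x ^ (2 : ℝ) * m ^ (q - 2)
            ≤ x ^ (2 : ℝ) * (C₁ ^ (q - p) * r ^ (n / q * (q - p)) * m ^ (p - 2)) := by gcongr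
          _ = C₁ ^ (q - p) * (x ^ (2 : ℝ) * (r ^ (n / q * (q - p)) * m ^ (p - 2))) := by ring
          _ ≤ _ := by rw [e2]; gcongr
    _ = ENNReal.ofReal (C₁ ^ (q - p)) * (weightedMoment β p F univ +
          ∫⁻ ξ : V, ENNReal.ofReal (‖ξ‖ ^ (-(n + n / q * p))) *
            (∫⁻ η in {η : V | ‖η‖ ≤ ‖ξ‖}, ‖F η‖ₑ) ^ p) := by
        rw [lintegral_const_mul' _ _ ENNReal.ofReal_ne_top, lintegral_add_left]
        · simp only [hMball, weightedMoment, Measure.restrict_univ]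
        · exact (Measurable.ennreal_ofReal (measurable_norm.pow_const _)).mul
            (hFm.enorm.pow_const _)
    _ ≤ ENNReal.ofReal (C₁ ^ (q - p)) * (1 + ENNReal.ofReal C₂ * 1) := by
        gcongr
        exact (h₂ F hFm).trans (by gcongr)
    _ = _ := by
        rw [mul_one, ENNReal.ofReal_mul (by positivity), ENNReal.ofReal_add zero_le_one hC₂.le,
          ENNReal.ofReal_one]

theorem fourierInv_const_mul (c : ℂ) (F : V → ℂ) (x : V) :
    𝓕⁻ (fun ξ => c * F ξ) x = c * 𝓕⁻ F x := by
  simp only [Real.fourierInv_eq, Circle.smul_def, smul_eq_mul, mul_left_comm _ c]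
  exact integral_const_mul c _

theorem lintegral_enorm_rpow_eq_eLpNorm {E : Type*} [NormedAddCommGroup E] (f : V → E) {p : ℝ}
    (hp : 0 < p) : ∫⁻ x, ‖f x‖ₑ ^ p = eLpNorm f (ENNReal.ofReal p) ^ p := by
  rw [eLpNorm_eq_lintegral_rpow_enorm_toReal (by simpa using hp) (by simp),
    ENNReal.toReal_ofReal hp.le, ← ENNReal.rpow_mul, one_div_mul_cancel hp.ne', ENNReal.rpow_one]

theorem weightedMoment_univ_eq (β : ℝ) {p : ℝ} (hp : 0 < p) (F : V → ℂ) :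
    weightedMoment β p F univ =
      eLpNorm (fun ξ => ‖ξ‖ ^ β * ‖F ξ‖) (ENNReal.ofReal p) ^ p := by
  rw [← lintegral_enorm_rpow_eq_eLpNorm _ hp, weightedMoment, Measure.restrict_univ]
  refine lintegral_congr fun ξ => ?_
  rw [enorm_mul, enorm_norm, ENNReal.mul_rpow_of_nonneg _ _ hp.le,
    Real.enorm_of_nonneg (by positivity), ENNReal.ofReal_rpow_of_nonneg (by positivity) hp.le,
    ← Real.rpow_mul (norm_nonneg _)]

/-- Pitt's inequality. -/
theorem exists_eLpNorm_fourierInv_le [Nontrivial V] {β p q : ℝ} (hp : 1 < p) (hpq : p ≤ q)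
    (hβ : 0 < β) (hβe : β = finrank ℝ V * (1 - 1 / p - 1 / q)) :
    ∃ C : ℝ, 0 < C ∧ ∀ F : V → ℂ, Measurable F → Integrable F → MemLp F 2 →
      eLpNorm (𝓕⁻ F) (ENNReal.ofReal q) ≤ ENNReal.ofReal C *
        eLpNorm (fun ξ => ‖ξ‖ ^ β * ‖F ξ‖) (ENNReal.ofReal p) := by
  have hp0 : 0 < p := by linarith
  have hq0 : 0 < q := by linarith
  have hq : 2 < q := by
    have hn : (0 : ℝ) < finrank ℝ V := by exact_mod_cast finrank_pos
    rw [hβe] at hβ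
    have h1 := pos_of_mul_pos_right hβ hn.le
    have h2 : 1 / q ≤ 1 / p := one_div_le_one_div_of_le hp0 hpq
    have h3 : 1 / q < 1 / 2 := by linarith
    exact (one_div_lt_one_div hq0 two_pos).1 h3
  obtain ⟨C, hC, h⟩ : ∃ C : ℝ, 0 < C ∧ ∀ F : V → ℂ, Measurable F → Integrable F → MemLp F 2 →
      weightedMoment β p F univ ≤ 1 → ∫⁻ x, ‖𝓕⁻ F x‖ₑ ^ q ≤ ENNReal.ofReal C := by
    rcases lt_or_ge p 2 with h2 | h2
    · exact exists_lintegral_fourierInv_rpow_le_of_lt_two hp h2 hq hβ hβe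
    · exact exists_lintegral_fourierInv_rpow_le_of_two_le h2 hpq hq hβe
  refine ⟨C ^ (1 / q), by positivity, fun F hFm hF hF2 => ?_⟩
  set H := eLpNorm (fun ξ => ‖ξ‖ ^ β * ‖F ξ‖) (ENNReal.ofReal p) with hH
  have key : ∀ k : ℝ, 0 < k → H ≤ ENNReal.ofReal k →
      eLpNorm (𝓕⁻ F) (ENNReal.ofReal q) ≤ ENNReal.ofReal (C ^ (1 / q)) * ENNReal.ofReal k := by
    intro k hk hHk
    have h1 := h (fun ξ => ((k⁻¹ : ℝ) : ℂ) * F ξ) (hFm.const_mul _) (hF.const_mul _)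
      (hF2.const_mul _) (by
        rw [weightedMoment_univ_eq _ hp0]
        refine ENNReal.rpow_le_one ?_ hp0.le
        have : (fun ξ : V => ‖ξ‖ ^ β * ‖((k⁻¹ : ℝ) : ℂ) * F ξ‖) =
            k⁻¹ • fun ξ : V => ‖ξ‖ ^ β * ‖F ξ‖ := by
          ext ξ
          simp only [norm_mul, Complex.norm_real, Real.norm_of_nonneg (inv_nonneg.2 hk.le),
            Pi.smul_apply, smul_eq_mul]
          ring
        rw [this, eLpNorm_const_smul, Real.enorm_of_nonneg (inv_nonneg.2 hk.le), ← hH]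
        calc _ ≤ ENNReal.ofReal k⁻¹ * ENNReal.ofReal k := by gcongr
          _ = 1 := by rw [← ENNReal.ofReal_mul (by positivity), inv_mul_cancel₀ hk.ne',
            ENNReal.ofReal_one])
    have h2 : (𝓕⁻ fun ξ => ((k⁻¹ : ℝ) : ℂ) * F ξ) = ((k⁻¹ : ℝ) : ℂ) • 𝓕⁻ F := by
      ext x
      rw [fourierInv_const_mul]
      rfl
    rw [lintegral_enorm_rpow_eq_eLpNorm _ hq0, h2, eLpNorm_const_smul] at h1
    have h3 := ENNReal.rpow_le_rpow h1 (z := 1 / q) (by positivity)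
    rw [← ENNReal.rpow_mul, mul_one_div_cancel hq0.ne', ENNReal.rpow_one,
      ENNReal.ofReal_rpow_of_pos hC, ← ofReal_norm, Complex.norm_real,
      Real.norm_of_nonneg (inv_nonneg.2 hk.le)] at h3
    calc _ = ENNReal.ofReal k * (ENNReal.ofReal k⁻¹ * eLpNorm (𝓕⁻ F) (ENNReal.ofReal q)) := by
          rw [← mul_assoc, ← ENNReal.ofReal_mul hk.le, mul_inv_cancel₀ hk.ne', ENNReal.ofReal_one,
            one_mul]
      _ ≤ _ := by rw [mul_comm (ENNReal.ofReal (C ^ (1 / q)))]; gcongr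
  rcases eq_or_ne H ∞ with hinf | hfin
  · rw [hinf, ENNReal.mul_top (by simpa using by positivity)]
    exact le_top
  have hlim : Tendsto (fun ε : ℝ => ENNReal.ofReal (C ^ (1 / q)) * ENNReal.ofReal (H.toReal + ε))
      (𝓝[>] 0) (𝓝 (ENNReal.ofReal (C ^ (1 / q)) * H)) := by
    refine ENNReal.Tendsto.const_mul ?_ (Or.inr ENNReal.ofReal_ne_top)
    have : Tendsto (fun ε : ℝ => ENNReal.ofReal (H.toReal + ε)) (𝓝 0)
        (𝓝 (ENNReal.ofReal (H.toReal + 0))) :=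
      (ENNReal.continuous_ofReal.comp (continuous_const.add continuous_id)).tendsto 0
    rw [add_zero, ENNReal.ofReal_toReal hfin] at this
    exact this.mono_left nhdsWithin_le_nhds
  refine ge_of_tendsto hlim ?_
  filter_upwards [self_mem_nhdsWithin] with ε hε
  have hε0 : (0 : ℝ) < ε := hε
  refine key _ (by positivity) ?_
  rw [ENNReal.le_ofReal_iff_toReal_le hfin (by positivity)]
  linarith

theorem eLpNorm_one_add_norm_rpow_lt_top {s : ℝ≥0∞} (hs : s ≠ 0) {γ : ℝ}
    (hγ : finrank ℝ V * s⁻¹.toReal < γ) :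
    eLpNorm (fun ξ : V => (1 + ‖ξ‖) ^ (-γ)) s < ∞ := by
  have hγ0 : 0 ≤ γ := le_trans (by positivity) hγ.le
  rcases eq_or_ne s ∞ with rfl | hs'
  · refine lt_of_le_of_lt (eLpNormEssSup_le_of_ae_bound (C := 1) (Eventually.of_forall fun ξ => ?_))
      ENNReal.ofReal_lt_top
    rw [Real.norm_of_nonneg (by positivity)]
    exact Real.rpow_le_one_of_one_le_of_nonpos (by linarith [norm_nonneg ξ]) (by linarith)
  · have hs0 : 0 < s.toReal := ENNReal.toReal_pos hs hs'
    rw [eLpNorm_lt_top_iff_lintegral_rpow_enorm_lt_top hs hs']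
    have h : (finrank ℝ V : ℝ) < γ * s.toReal := by
      rw [ENNReal.toReal_inv] at hγ
      exact (mul_inv_lt_iff₀ hs0).1 hγ
    convert finite_integral_one_add_norm (μ := (volume : Measure V)) h using 3 with ξ
    rw [Real.enorm_of_nonneg (by positivity), ENNReal.ofReal_rpow_of_nonneg (by positivity) hs0.le,
      ← Real.rpow_mul (by positivity), neg_mul]

theorem exists_eLpNorm_one_add_norm_rpow_mul_le {p r : ℝ≥0∞} (hr : 1 ≤ r) (hrp : r ≤ p) {γ : ℝ}
    (hγ : finrank ℝ V * (r⁻¹.toReal - p⁻¹.toReal) < γ) :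
    ∃ C : ℝ, 0 < C ∧ ∀ H : V → ℝ, Measurable H →
      eLpNorm (fun ξ => (1 + ‖ξ‖) ^ (-γ) * H ξ) r ≤ ENNReal.ofReal C * eLpNorm H p := by
  have hr0 : r⁻¹ ≠ ∞ := ENNReal.inv_ne_top.2 (one_pos.trans_le hr).ne'
  have hle : p⁻¹ ≤ r⁻¹ := ENNReal.inv_le_inv.2 hrp
  have htri : ENNReal.HolderTriple (r⁻¹ - p⁻¹)⁻¹ p r := ⟨by
    rw [inv_inv, tsub_add_cancel_of_le hle]⟩
  have hfin := eLpNorm_one_add_norm_rpow_lt_top (V := V) (s := (r⁻¹ - p⁻¹)⁻¹) (γ := γ)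
    (ENNReal.inv_ne_zero.2 (ENNReal.sub_ne_top hr0))
    (by rwa [inv_inv, ENNReal.toReal_sub_of_le hle hr0])
  refine ⟨(eLpNorm (fun ξ : V => (1 + ‖ξ‖) ^ (-γ)) (r⁻¹ - p⁻¹)⁻¹).toReal + 1, by positivity,
    fun H hH => ?_⟩
  have hwm : Measurable fun ξ : V => (1 + ‖ξ‖) ^ (-γ) := (measurable_norm.const_add 1).pow_const _
  refine (eLpNorm_smul_le_mul_eLpNorm (p := (r⁻¹ - p⁻¹)⁻¹) (q := p) hH.aestronglyMeasurable
    hwm.aestronglyMeasurable).trans ?_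
  gcongr
  rw [ENNReal.le_ofReal_iff_toReal_le hfin.ne (by positivity)]
  linarith

instance : IsFiniteMeasure (volume.restrict (Metric.closedBall (0 : V) 1)) :=
  ⟨by simpa using (isCompact_closedBall (0 : V) 1).measure_lt_top⟩

theorem exists_eLpNorm_fourierInv_closedBall_le_one {q : ℝ≥0∞} :
    ∃ C : ℝ, 0 < C ∧ ∀ F : V → ℂ,
      eLpNorm (𝓕⁻ F) q (volume.restrict (Metric.closedBall 0 1)) ≤ ENNReal.ofReal C * eLpNorm F 1 := by
  set v := (volume.restrict (Metric.closedBall (0 : V) 1)) univ ^ q.toReal⁻¹ with hv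
  have hvfin : v ≠ ∞ := ENNReal.rpow_ne_top_of_nonneg (by positivity) (measure_ne_top _ _)
  refine ⟨v.toReal + 1, by positivity, fun F => ?_⟩
  refine (eLpNorm_le_of_ae_enorm_bound (C := eLpNorm F 1) (Eventually.of_forall fun x => ?_)).trans ?_
  · rw [eLpNorm_one_eq_lintegral_enorm]
    exact enorm_fourierInv_le_lintegral F x
  · rw [smul_eq_mul, mul_comm, ← hv]
    gcongr
    rw [ENNReal.le_ofReal_iff_toReal_le hvfin (by positivity)]
    linarith

theorem exists_eLpNorm_closedBall_le {q r : ℝ≥0∞} (hqr : q ≤ r) (hq : 1 ≤ q) :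
    ∃ C : ℝ, 0 < C ∧ ∀ f : V → ℂ, Continuous f →
      eLpNorm f q (volume.restrict (Metric.closedBall 0 1)) ≤ ENNReal.ofReal C * eLpNorm f r := by
  have hexp : 0 ≤ 1 / q.toReal - 1 / r.toReal := by
    have := ENNReal.toReal_mono (ENNReal.inv_ne_top.2 (one_pos.trans_le hq).ne')
      (ENNReal.inv_le_inv.2 hqr)
    rw [ENNReal.toReal_inv, ENNReal.toReal_inv] at this
    simpa using this
  set v := (volume.restrict (Metric.closedBall (0 : V) 1)) univ ^ (1 / q.toReal - 1 / r.toReal)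
  have hvfin : v ≠ ∞ := ENNReal.rpow_ne_top_of_nonneg hexp (measure_ne_top _ _)
  refine ⟨v.toReal + 1, by positivity, fun f hf => ?_⟩
  refine (eLpNorm_le_eLpNorm_mul_rpow_measure_univ hqr hf.aestronglyMeasurable).trans ?_
  rw [mul_comm]
  gcongr
  · rw [ENNReal.le_ofReal_iff_toReal_le hvfin (by positivity)]
    linarith
  · exact Measure.restrict_le_self

/-- `F` is dominated by `‖ξ‖ ^ (-b) * (1 + ‖ξ‖) ^ (-(β - b)) * H ξ` for every `0 ≤ b ≤ β`. -/
def Dominated (β : ℝ) (F : V → ℂ) (H : V → ℝ) : Prop :=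
  ∀ b : ℝ, 0 ≤ b → b ≤ β → ∀ ξ, ‖ξ‖ ^ b * ‖F ξ‖ ≤ (1 + ‖ξ‖) ^ (-(β - b)) * H ξ

theorem exists_eLpNorm_fourierInv_closedBall_le [Nontrivial V] {p q : ℝ≥0∞} (hp : 1 ≤ p)
    (hq : 1 ≤ q) {β : ℝ} (hβ : 0 < β)
    (hA : (p ≤ q ∧ q ≠ ∞ ∧ β = finrank ℝ V * (1 - q⁻¹.toReal - p⁻¹.toReal)) ∨
      finrank ℝ V * (1 - q⁻¹.toReal - p⁻¹.toReal) < β)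
    (hB : 2 ≤ q ∨ p ≤ 2 ∨ finrank ℝ V * (1 / 2 - p⁻¹.toReal) < β) :
    ∃ C : ℝ, 0 < C ∧ ∀ (F : V → ℂ) (H : V → ℝ), Measurable F → Integrable F → MemLp F 2 →
      Measurable H → Dominated β F H →
      eLpNorm (𝓕⁻ F) q (volume.restrict (Metric.closedBall 0 1)) ≤
        ENNReal.ofReal C * eLpNorm H p := by
  have hn : (0 : ℝ) < finrank ℝ V := by exact_mod_cast finrank_pos
  have hq0 : q ≠ 0 := (one_pos.trans_le hq).ne'
  have hp0 : p ≠ 0 := (one_pos.trans_le hp).ne'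
  rcases hA with ⟨hpq, hqt, hβe⟩ | hA
  · have hpt : p ≠ ∞ := ne_top_of_le_ne_top hqt hpq
    have hpr : 1 ≤ p.toReal := by simpa using ENNReal.toReal_mono hpt hp
    have hp1 : 1 < p.toReal := by
      refine lt_of_le_of_ne hpr fun h => ?_
      rw [ENNReal.toReal_inv p, ← h] at hβe
      have : 0 ≤ finrank ℝ V * q⁻¹.toReal := by positivity
      rw [inv_one] at hβe
      linarith
    obtain ⟨C, hC, h⟩ := exists_eLpNorm_fourierInv_le (V := V) hp1
      (ENNReal.toReal_mono hqt hpq) hβ (by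
        rw [hβe, ENNReal.toReal_inv, ENNReal.toReal_inv, one_div, one_div]; ring)
    rw [ENNReal.ofReal_toReal hpt, ENNReal.ofReal_toReal hqt] at h
    refine ⟨C, hC, fun F H hFm hF hF2 hHm hdom => ?_⟩
    refine (eLpNorm_mono_measure _ Measure.restrict_le_self).trans ((h F hFm hF hF2).trans ?_)
    gcongr
    refine eLpNorm_mono_real fun ξ => ?_
    rw [Real.norm_of_nonneg (by positivity)]
    simpa using hdom β hβ.le le_rfl ξ
  by_cases hcase : q = ∞ ∨ p = 1
  · obtain ⟨C₁, hC₁, h₁⟩ := exists_eLpNorm_fourierInv_closedBall_le_one (V := V) (q := q)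
    obtain ⟨C₂, hC₂, h₂⟩ := exists_eLpNorm_one_add_norm_rpow_mul_le (V := V) (r := 1) le_rfl hp
      (γ := β) (by
        rcases hcase with rfl | rfl
        · simpa using hA
        · simpa using hβ)
    refine ⟨C₁ * C₂, by positivity, fun F H hFm hF hF2 hHm hdom => ?_⟩
    rw [ENNReal.ofReal_mul hC₁.le, mul_assoc]
    refine (h₁ F).trans ?_
    gcongr
    refine le_trans (eLpNorm_mono_real fun ξ => ?_) (h₂ H hHm)
    simpa using hdom 0 le_rfl hβ.le ξ
  push Not at hcase
  obtain ⟨hqt, hp1⟩ := hcase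
  have hp1' : 1 < p := lt_of_le_of_ne hp (Ne.symm hp1)
  set r : ℝ≥0∞ := min p 2 with hr
  have hr1 : 1 < r := lt_min hp1' (by norm_num)
  have hr2 : r ≤ 2 := min_le_right _ _
  have hrp : r ≤ p := min_le_left _ _
  have hrt : r ≠ ∞ := ne_top_of_le_ne_top (by simp) hr2
  have hr1' : 1 < r.toReal := by simpa using (ENNReal.toReal_lt_toReal (by simp) hrt).2 hr1
  have hr2' : r.toReal ≤ 2 := by simpa using ENNReal.toReal_mono (by simp) hr2
  have hrinv : r⁻¹.toReal = 1 / r.toReal := by rw [ENNReal.toReal_inv, one_div]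
  have hrinv1 : 1 / r.toReal < 1 := by rw [div_lt_one (by linarith)]; exact hr1'
  have hrinv2 : 1 / 2 ≤ 1 / r.toReal := one_div_le_one_div_of_le (by linarith) hr2'
  have hqinv : 0 < q⁻¹.toReal :=
    ENNReal.toReal_pos (ENNReal.inv_ne_zero.2 hqt) (ENNReal.inv_ne_top.2 hq0)
  have hrβ : finrank ℝ V * (r⁻¹.toReal - p⁻¹.toReal) < β := by
    rcases le_total p 2 with h2 | h2
    · rw [hr, min_eq_left h2, sub_self, mul_zero]; exact hβ
    · have e1 : r⁻¹.toReal = 1 / 2 := by rw [hr, min_eq_right h2, ENNReal.toReal_inv]; norm_num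
      rw [e1]
      rcases hB with h3 | h3 | h3
      · refine lt_of_le_of_lt ?_ hA
        have : q⁻¹.toReal ≤ 1 / 2 := by
          have := ENNReal.toReal_mono (by simp) (ENNReal.inv_le_inv.2 h3)
          simpa [ENNReal.toReal_inv] using this
        gcongr
        linarith
      · have e2 : p = 2 := le_antisymm h3 h2
        rw [e2, ENNReal.toReal_inv]
        norm_num
        exact hβ
      · exact h3
  have hex : max 0 (1 - p⁻¹.toReal - β / finrank ℝ V) < min q⁻¹.toReal (1 - 1 / r.toReal) := by
    refine max_lt (lt_min hqinv (by linarith)) (lt_min ?_ ?_)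
    · have := (lt_div_iff₀' hn).2 hA
      linarith
    · have := (lt_div_iff₀' hn).2 hrβ
      rw [hrinv] at this
      linarith
  obtain ⟨y, hy1, hy2⟩ := exists_between hex
  obtain ⟨hy0, hyβ⟩ := max_lt_iff.1 hy1
  obtain ⟨hyq, hyr⟩ := lt_min_iff.1 hy2
  set b := finrank ℝ V * (1 - 1 / r.toReal - y) with hb
  have hb0 : 0 < b := mul_pos hn (by linarith)
  have hγ : finrank ℝ V * (r⁻¹.toReal - p⁻¹.toReal) < β - b := by
    rw [hb, hrinv]
    rw [sub_lt_comm, lt_div_iff₀' hn] at hyβ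
    linarith
  have hinvle : p⁻¹.toReal ≤ r⁻¹.toReal :=
    ENNReal.toReal_mono (ENNReal.inv_ne_top.2 (one_pos.trans hr1).ne') (ENNReal.inv_le_inv.2 hrp)
  have hbβ : b ≤ β := by
    have : 0 ≤ finrank ℝ V * (r⁻¹.toReal - p⁻¹.toReal) := mul_nonneg hn.le (by linarith)
    linarith
  have hry : r.toReal ≤ 1 / y := by
    rw [le_div_iff₀ hy0, ← le_div_iff₀' (by linarith)]
    linarith
  obtain ⟨C₁, hC₁, h₁⟩ := exists_eLpNorm_fourierInv_le (V := V) hr1' hry hb0 (by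
    rw [hb, one_div_one_div])
  rw [ENNReal.ofReal_toReal hrt] at h₁
  obtain ⟨C₂, hC₂, h₂⟩ := exists_eLpNorm_one_add_norm_rpow_mul_le (V := V) hr1.le hrp hγ
  have hqy : q ≤ ENNReal.ofReal (1 / y) := by
    rw [ENNReal.le_ofReal_iff_toReal_le hqt (by positivity), le_one_div (ENNReal.toReal_pos hq0 hqt)
      hy0, one_div, ← ENNReal.toReal_inv]
    exact hyq.le
  obtain ⟨C₃, hC₃, h₃⟩ := exists_eLpNorm_closedBall_le (V := V) hqy hq
  refine ⟨C₃ * (C₁ * C₂), by positivity, fun F H hFm hF hF2 hHm hdom => ?_⟩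
  rw [ENNReal.ofReal_mul hC₃.le, ENNReal.ofReal_mul hC₁.le, mul_assoc, mul_assoc]
  refine (h₃ _ (continuous_fourierInv hF)).trans ?_
  gcongr
  refine (h₁ F hFm hF hF2).trans ?_
  gcongr
  refine le_trans (eLpNorm_mono_real fun ξ => ?_) (h₂ H hHm)
  rw [Real.norm_of_nonneg (by positivity)]
  exact hdom b hb0.le hbβ ξ

/-- The Fourier multiplier `(1 - e^{2πi⟨h, ξ⟩}) ^ k` of the `k`-fold difference operator, applied
to `G`. -/
noncomputable def diffMul (h : V) (k : ℕ) (G : V → ℂ) (ξ : V) : ℂ :=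
  (1 - (𝐞 (inner ℝ h ξ) : ℂ)) ^ k * G ξ

theorem norm_one_sub_fourierChar_le (h ξ : V) :
    ‖1 - (𝐞 (inner ℝ h ξ) : ℂ)‖ ≤ 2 ∧ ‖1 - (𝐞 (inner ℝ h ξ) : ℂ)‖ ≤ 2 * Real.pi * ‖h‖ * ‖ξ‖ := by
  constructor
  · refine (norm_sub_le _ _).trans ?_
    rw [norm_one, Circle.norm_coe]
    norm_num
  · rw [norm_sub_rev, Real.fourierChar_apply, mul_comm]
    refine (Real.norm_exp_I_mul_ofReal_sub_one_le).trans ?_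
    rw [norm_mul, Real.norm_of_nonneg (by positivity), mul_assoc _ ‖h‖]
    gcongr
    exact norm_inner_le_norm h ξ

theorem continuous_diffMul {h : V} {k : ℕ} {G : V → ℂ} (hG : Continuous G) :
    Continuous (diffMul h k G) := by
  unfold diffMul
  have : Continuous fun ξ : V => (𝐞 (inner ℝ h ξ) : ℂ) :=
    continuous_subtype_val.comp (Real.continuous_fourierChar.comp (by fun_prop))
  fun_prop

theorem norm_diffMul_le (h : V) (k : ℕ) (G : V → ℂ) (ξ : V) :
    ‖diffMul h k G ξ‖ ≤ 2 ^ k * ‖G ξ‖ := by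
  rw [diffMul, norm_mul, norm_pow]
  gcongr
  exact (norm_one_sub_fourierChar_le h ξ).1

theorem memLp_diffMul {h : V} {k : ℕ} {G : V → ℂ} {p : ℝ≥0∞} (hG : Continuous G)
    (hGp : MemLp G p) : MemLp (diffMul h k G) p :=
  hGp.of_le_mul (continuous_diffMul hG).aestronglyMeasurable
    (Eventually.of_forall (norm_diffMul_le h k G))

theorem fourierInv_diffMul_succ {h : V} {k : ℕ} {G : V → ℂ} (hG : Continuous G)
    (hGi : Integrable G) (x : V) :
    𝓕⁻ (diffMul h (k + 1) G) x = 𝓕⁻ (diffMul h k G) x - 𝓕⁻ (diffMul h k G) (x + h) := by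
  have hi : Integrable (diffMul h k G) :=
    memLp_one_iff_integrable.1 (memLp_diffMul hG (memLp_one_iff_integrable.2 hGi))
  have hconv : ∀ x : V, Integrable fun v => 𝐞 (inner ℝ v x) • diffMul h k G v := by
    intro x
    have := (Real.fourierIntegral_convergent_iff (μ := volume) (f := diffMul h k G) (-x)).2 hi
    simpa using this
  rw [Real.fourierInv_eq, Real.fourierInv_eq, Real.fourierInv_eq, ← integral_sub (hconv _) (hconv _)]
  refine integral_congr_ae (Eventually.of_forall fun v => ?_)
  simp only [diffMul, Circle.smul_def, smul_eq_mul, inner_add_right, AddChar.map_add_eq_mul,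
    Circle.coe_mul, real_inner_comm h v]
  ring

theorem dominated_diffMul {h : V} (hh : ‖h‖ = 2) {N : ℕ} {β : ℝ} (hβ : 0 < β) (hN : β ≤ N)
    (G : V → ℂ) :
    Dominated β (diffMul h N G) fun ξ => (4 * Real.pi) ^ N * 2 ^ β * (‖ξ‖ ^ β * ‖G ξ‖) := by
  intro b hb hbβ ξ
  set r := ‖ξ‖ with hr
  have hr0 : 0 ≤ r := norm_nonneg _
  have hm : ‖diffMul h N G ξ‖ ≤ (4 * Real.pi) ^ N * (min 1 r) ^ N * ‖G ξ‖ := by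
    rw [diffMul, norm_mul, norm_pow, ← mul_pow]
    gcongr
    obtain ⟨h1, h2⟩ := norm_one_sub_fourierChar_le h ξ
    rw [hh] at h2
    have := Real.pi_gt_three
    rcases min_choice 1 r with h3 | h3 <;> rw [h3]
    · linarith
    · linarith
  have key : r ^ b * (min 1 r) ^ N ≤ (1 + r) ^ (-(β - b)) * (2 ^ β * r ^ β) := by
    have hβb : 0 ≤ β - b := by linarith
    rw [Real.rpow_neg (by positivity), ← div_eq_inv_mul, le_div_iff₀ (by positivity)]
    rcases le_total r 1 with h1 | h1
    · have e1 : (min 1 r) ^ N ≤ r ^ β := by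
        rw [min_eq_right h1, ← Real.rpow_natCast]
        rcases hr0.eq_or_lt with h0 | h0
        · rw [← h0, Real.zero_rpow (by linarith), Real.zero_rpow hβ.ne']
        · exact Real.rpow_le_rpow_of_exponent_ge h0 h1 hN
      have e2 : r ^ b ≤ 1 := Real.rpow_le_one hr0 h1 hb
      have e3 : (1 + r) ^ (β - b) ≤ 2 ^ β :=
        calc (1 + r) ^ (β - b) ≤ 2 ^ (β - b) := by gcongr; linarith
          _ ≤ 2 ^ β := Real.rpow_le_rpow_of_exponent_le (by norm_num) (by linarith)
      calc r ^ b * (min 1 r) ^ N * (1 + r) ^ (β - b) ≤ 1 * r ^ β * 2 ^ β := by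
            have := le_min zero_le_one hr0
            gcongr
        _ = _ := by ring
    · rw [min_eq_left h1, one_pow, mul_one]
      have hr1 : 0 < r := by linarith
      have e3 : (1 + r) ^ (β - b) ≤ 2 ^ β * r ^ (β - b) :=
        calc (1 + r) ^ (β - b) ≤ (2 * r) ^ (β - b) := by gcongr; linarith
          _ = 2 ^ (β - b) * r ^ (β - b) := Real.mul_rpow (by norm_num) hr0
          _ ≤ 2 ^ β * r ^ (β - b) := mul_le_mul_of_nonneg_right
            (Real.rpow_le_rpow_of_exponent_le (by norm_num) (by linarith)) (by positivity)
      calc r ^ b * (1 + r) ^ (β - b) ≤ r ^ b * (2 ^ β * r ^ (β - b)) := by gcongr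
        _ = 2 ^ β * (r ^ b * r ^ (β - b)) := by ring
        _ = _ := by rw [← Real.rpow_add hr1, add_sub_cancel]
  calc r ^ b * ‖diffMul h N G ξ‖ ≤ r ^ b * ((4 * Real.pi) ^ N * (min 1 r) ^ N * ‖G ξ‖) := by gcongr
    _ = (4 * Real.pi) ^ N * (r ^ b * (min 1 r) ^ N) * ‖G ξ‖ := by ring
    _ ≤ (4 * Real.pi) ^ N * ((1 + r) ^ (-(β - b)) * (2 ^ β * r ^ β)) * ‖G ξ‖ := by gcongr
    _ = _ := by ring

theorem eLpNorm_comp_add_right_closedBall_le {f : V → ℂ} (hf : Continuous f) (q : ℝ≥0∞) {a : V}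
    (ha : 2 ≤ ‖a‖) :
    eLpNorm (fun x => f (x + a)) q (volume.restrict (Metric.closedBall 0 1)) ≤
      eLpNorm f q (volume.restrict {x | 1 ≤ ‖x‖}) := by
  have hS : MeasurableSet {x : V | 1 ≤ ‖x‖} := measurableSet_le measurable_const measurable_norm
  rw [← eLpNorm_indicator_eq_eLpNorm_restrict Metric.isClosed_closedBall.measurableSet,
    ← eLpNorm_indicator_eq_eLpNorm_restrict hS,
    ← eLpNorm_comp_measurePreserving (hf.aestronglyMeasurable.indicator hS)
      (measurePreserving_add_right volume a)]
  refine eLpNorm_mono fun x => ?_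
  by_cases hx : x ∈ Metric.closedBall (0 : V) 1
  · have h1 : 1 ≤ ‖x + a‖ := by
      have := norm_sub_le (x + a) x
      rw [add_sub_cancel_left] at this
      have := mem_closedBall_zero_iff.1 hx
      linarith
    rw [indicator_of_mem hx, Function.comp_apply, indicator_of_mem (by exact h1)]
  · rw [indicator_of_notMem hx]
    simp

theorem eLpNorm_closedBall_le_fourierInv_diffMul {f : V → ℂ} (hf : Continuous f)
    (hfi : Integrable f) (hG : Continuous (𝓕 f)) (hGi : Integrable (𝓕 f)) {q : ℝ≥0∞} (hq : 1 ≤ q)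
    {h : V} (hh : ‖h‖ = 2) (N : ℕ) :
    eLpNorm f q (volume.restrict (Metric.closedBall 0 1)) ≤
      eLpNorm (𝓕⁻ (diffMul h N (𝓕 f))) q (volume.restrict (Metric.closedBall 0 1)) +
        2 ^ N * eLpNorm f q (volume.restrict {x | 1 ≤ ‖x‖}) := by
  set μ := volume.restrict (Metric.closedBall (0 : V) 1)
  set T := eLpNorm f q (volume.restrict {x | 1 ≤ ‖x‖})
  set Φ : ℕ → V → ℂ := fun k => 𝓕⁻ (diffMul h k (𝓕 f)) with hΦ
  have hΦc : ∀ k, Continuous (Φ k) := fun k => continuous_fourierInv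
    (memLp_one_iff_integrable.1 (memLp_diffMul hG (memLp_one_iff_integrable.2 hGi)))
  have hΦ0 : Φ 0 = f := by
    have : diffMul h 0 (𝓕 f) = 𝓕 f := by ext ξ; simp [diffMul]
    rw [hΦ]
    dsimp only
    rw [this, hf.fourierInv_fourier_eq hfi hGi]
  have hΦs : ∀ k x, Φ (k + 1) x = Φ k x - Φ k (x + h) := fun k x =>
    fourierInv_diffMul_succ hG hGi x
  have hm : ∀ k j, AEStronglyMeasurable (fun x => Φ k (x + j)) μ := fun k j =>
    ((hΦc k).comp (continuous_id.add continuous_const)).aestronglyMeasurable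
  have hfar : ∀ k j : ℕ, 1 ≤ j → eLpNorm (fun x => Φ k (x + (j : ℝ) • h)) q μ ≤ 2 ^ k * T := by
    intro k
    induction k with
    | zero =>
      intro j hj
      rw [pow_zero, one_mul, hΦ0]
      refine eLpNorm_comp_add_right_closedBall_le hf q ?_
      have : (1 : ℝ) ≤ j := by exact_mod_cast hj
      rw [norm_smul, hh, Real.norm_of_nonneg (by positivity)]
      linarith
    | succ k ih =>
      intro j hj
      have : (fun x => Φ (k + 1) (x + (j : ℝ) • h)) =
          (fun x => Φ k (x + (j : ℝ) • h)) - fun x => Φ k (x + ((j + 1 : ℕ) : ℝ) • h) := by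
        ext x
        simp only [Pi.sub_apply, hΦs]
        congr 2
        push_cast
        rw [add_smul, one_smul, add_assoc]
      rw [this, pow_succ, mul_two, add_mul]
      exact (eLpNorm_sub_le (hm _ _) (hm _ _) hq).trans (add_le_add (ih j hj) (ih _ (by omega)))
  have hnear : ∀ k, eLpNorm f q μ ≤ eLpNorm (Φ k) q μ + 2 ^ k * T := by
    intro k
    induction k with
    | zero => rw [hΦ0]; exact le_self_add
    | succ k ih =>
      have : Φ k = Φ (k + 1) + fun x => Φ k (x + ((1 : ℕ) : ℝ) • h) := by
        ext x
        simp [hΦs]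
      have h2 : eLpNorm (Φ k) q μ ≤ eLpNorm (Φ (k + 1)) q μ + 2 ^ k * T := by
        calc eLpNorm (Φ k) q μ = eLpNorm (Φ (k + 1) + fun x => Φ k (x + ((1 : ℕ) : ℝ) • h)) q μ :=
              congrArg (fun g => eLpNorm g q μ) this
          _ ≤ _ := (eLpNorm_add_le (hΦc _).aestronglyMeasurable (hm _ _) hq).trans
            (add_le_add le_rfl (hfar k 1 le_rfl))
      refine ih.trans ((add_le_add h2 le_rfl).trans_eq ?_)
      rw [pow_succ]
      ring
  exact hnear N

theorem eLpNorm_le_add_closedBall {f : V → ℂ} (hf : Continuous f) {q : ℝ≥0∞} (hq : 1 ≤ q) :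
    eLpNorm f q ≤ eLpNorm f q (volume.restrict (Metric.closedBall 0 1)) +
      eLpNorm f q (volume.restrict {x | 1 ≤ ‖x‖}) := by
  have hS : MeasurableSet {x : V | 1 ≤ ‖x‖} := measurableSet_le measurable_const measurable_norm
  rw [← eLpNorm_indicator_eq_eLpNorm_restrict Metric.isClosed_closedBall.measurableSet,
    ← eLpNorm_indicator_eq_eLpNorm_restrict hS]
  refine le_trans (eLpNorm_mono_enorm fun x => ?_) (eLpNorm_add_le
    (f := fun x => ‖(Metric.closedBall (0 : V) 1).indicator f x‖)
    (g := fun x => ‖{x : V | 1 ≤ ‖x‖}.indicator f x‖)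
    (hf.aestronglyMeasurable.indicator
      Metric.isClosed_closedBall.measurableSet).norm
    (hf.aestronglyMeasurable.indicator hS).norm hq) |>.trans_eq ?_
  · rw [Pi.add_apply, Real.enorm_of_nonneg (by positivity), ← ofReal_norm]
    apply ENNReal.ofReal_le_ofReal
    rcases le_total ‖x‖ 1 with hx | hx
    · rw [indicator_of_mem (by simpa using hx)]
      exact le_add_of_nonneg_right (norm_nonneg _)
    · rw [indicator_of_mem (s := {x : V | 1 ≤ ‖x‖}) (by exact hx)]
      exact le_add_of_nonneg_left (norm_nonneg _)
  · rw [eLpNorm_norm, eLpNorm_norm]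

theorem exists_heisenberg_inequality [Nontrivial V] {p q : ℝ≥0∞} (hp : 1 ≤ p)
    (hq : 1 ≤ q) {α β : ℝ} (hα : 0 < α) (hβ : 0 < β)
    (hA : (p ≤ q ∧ q ≠ ∞ ∧ β = finrank ℝ V * (1 - q⁻¹.toReal - p⁻¹.toReal)) ∨
      finrank ℝ V * (1 - q⁻¹.toReal - p⁻¹.toReal) < β)
    (hB : 2 ≤ q ∨ p ≤ 2 ∨ finrank ℝ V * (1 / 2 - p⁻¹.toReal) < β) :
    ∃ C : ℝ, 0 < C ∧ ∀ f : SchwartzMap V ℂ,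
      eLpNorm f q ≤ ENNReal.ofReal C * (eLpNorm (fun x => ‖x‖ ^ α * ‖f x‖) q +
        eLpNorm (fun ξ => ‖ξ‖ ^ β * ‖𝓕 (⇑f) ξ‖) p) := by
  obtain ⟨C, hC, h⟩ := exists_eLpNorm_fourierInv_closedBall_le (V := V) hp hq hβ hA hB
  obtain ⟨N, hN⟩ := exists_nat_ge β
  obtain ⟨v, hv⟩ := exists_norm_eq V (zero_le_two (α := ℝ))
  set K := (4 * Real.pi) ^ N * 2 ^ β with hK
  have hK0 : 0 < K := by positivity
  refine ⟨C * K + (2 ^ N + 1), by positivity, fun f => ?_⟩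
  set X := eLpNorm (fun x => ‖x‖ ^ α * ‖f x‖) q with hX
  set Y := eLpNorm (fun ξ => ‖ξ‖ ^ β * ‖𝓕 (⇑f) ξ‖) p with hY
  have hFc : Continuous (𝓕 (⇑f)) := by
    rw [← SchwartzMap.fourier_coe]; exact (𝓕 f).continuous
  have hFp : ∀ r : ℝ≥0∞, MemLp (𝓕 (⇑f)) r := fun r => by
    rw [← SchwartzMap.fourier_coe]; exact (𝓕 f).memLp r
  have hFi : Integrable (𝓕 (⇑f)) := memLp_one_iff_integrable.1 (hFp 1)
  have hS : MeasurableSet {x : V | 1 ≤ ‖x‖} := measurableSet_le measurable_const measurable_norm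
  have hT : eLpNorm f q (volume.restrict {x | 1 ≤ ‖x‖}) ≤ X := by
    rw [← eLpNorm_indicator_eq_eLpNorm_restrict hS]
    refine eLpNorm_mono_real fun x => ?_
    by_cases hx : 1 ≤ ‖x‖
    · rw [indicator_of_mem (by exact hx)]
      exact le_mul_of_one_le_left (norm_nonneg _) (Real.one_le_rpow hx hα.le)
    · rw [indicator_of_notMem (by exact hx), norm_zero]
      positivity
  have hmain : eLpNorm (𝓕⁻ (diffMul v N (𝓕 (⇑f)))) q (volume.restrict (Metric.closedBall 0 1)) ≤
      ENNReal.ofReal (C * K) * Y := by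
    refine (h _ _ (continuous_diffMul hFc).measurable (memLp_one_iff_integrable.1
      (memLp_diffMul hFc (hFp 1))) (memLp_diffMul hFc (hFp 2)) ?_
      (dominated_diffMul hv hβ hN _)).trans_eq ?_
    · exact ((measurable_norm.pow_const _).mul hFc.measurable.norm).const_mul _
    · have : (fun ξ : V => (4 * Real.pi) ^ N * 2 ^ β * (‖ξ‖ ^ β * ‖𝓕 (⇑f) ξ‖)) =
          K • fun ξ : V => ‖ξ‖ ^ β * ‖𝓕 (⇑f) ξ‖ := rfl
      rw [this, eLpNorm_const_smul, Real.enorm_of_nonneg hK0.le, ENNReal.ofReal_mul hC.le,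
        mul_assoc]
  have hsplit := eLpNorm_le_add_closedBall f.continuous hq
  have hnear := eLpNorm_closedBall_le_fourierInv_diffMul f.continuous f.integrable hFc hFi hq hv N
  have hCK : 0 ≤ C * K := by positivity
  have hN2 : ENNReal.ofReal (2 ^ N + 1) = 2 ^ N + 1 := by
    rw [ENNReal.ofReal_add (by positivity) zero_le_one, ENNReal.ofReal_pow zero_le_two,
      ENNReal.ofReal_one, ENNReal.ofReal_ofNat]
  rw [ENNReal.ofReal_add hCK (by positivity), hN2, mul_add]
  refine (hsplit.trans (add_le_add (hnear.trans (add_le_add hmain (mul_le_mul_right hT _)))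
    hT)).trans ?_
  generalize ENNReal.ofReal (C * K) = a
  generalize (2 ^ N : ℝ≥0∞) = b
  calc a * Y + b * X + X = (b + 1) * X + a * Y := by ring
    _ ≤ (a + (b + 1)) * X + (a + (b + 1)) * Y :=
        add_le_add (mul_le_mul_left le_add_self _) (mul_le_mul_left le_self_add _)

end

section

section Gaussian

variable {V : Type*} [NormedAddCommGroup V] [InnerProductSpace ℝ V]

theorem norm_cexp_neg_mul_sq (b : ℂ) (t : ℝ) :
    ‖Complex.exp (-b * (t : ℂ) ^ 2)‖ = Real.exp (-b.re * t ^ 2) := by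
  rw [Complex.norm_exp, ← Complex.ofReal_pow, Complex.re_mul_ofReal, Complex.neg_re]

/-- The Gaussian `x ↦ exp (-b‖x‖²)`, for complex `b` with `0 < re b`, as a Schwartz function. -/
noncomputable def schwartzGaussian (V : Type*) [NormedAddCommGroup V] [InnerProductSpace ℝ V]
    {b : ℂ} (hb : 0 < b.re) : SchwartzMap V ℂ where
  toFun x := Complex.exp (-b * (‖x‖ : ℂ) ^ 2)
  smooth' := by
    have h : ContDiff ℝ (⊤ : ℕ∞) fun x : V => ((‖x‖ ^ 2 : ℝ) : ℂ) :=
      Complex.ofRealCLM.contDiff.comp (contDiff_norm_sq ℝ)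
    simp only [← Complex.ofReal_pow]
    exact (contDiff_const.mul h).cexp
  decay' k n := by
    obtain ⟨m, D, hD, hN⟩ :=
      (Function.hasTemperateGrowth_norm_sq (H := V)).norm_iteratedFDeriv_le_uniform n
    set g : ℝ → ℂ := fun t => Complex.exp (-b * t) with hg
    have hgs : ContDiff ℝ (⊤ : ℕ∞) g := (contDiff_const.mul Complex.ofRealCLM.contDiff).cexp
    have hgd : ∀ (i : ℕ) (t : ℝ), ‖iteratedFDeriv ℝ i g t‖ = ‖b‖ ^ i * Real.exp (-b.re * t) := by
      intro i t
      have : ∀ i : ℕ, iteratedDeriv i g = fun t : ℝ => (-b) ^ i * Complex.exp (-b * t) := by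
        intro i
        induction i with
        | zero => simp [hg]
        | succ i ih =>
          ext t
          rw [iteratedDeriv_succ, ih]
          have h1 : HasDerivAt (fun t : ℝ => Complex.exp (-b * t))
              (Complex.exp (-b * t) * (-b * 1)) t :=
            ((Complex.ofRealCLM.hasDerivAt (x := t)).const_mul (-b)).cexp
          rw [(h1.const_mul _).deriv]
          ring
      rw [norm_iteratedFDeriv_eq_norm_iteratedDeriv, this, norm_mul, norm_pow, norm_neg,
        Complex.norm_exp, Complex.re_mul_ofReal, Complex.neg_re]
    set M := k + m * n with hM
    obtain ⟨A, hA⟩ : ∃ A : ℝ, ∀ r : ℝ, 0 ≤ r → (1 + r) ^ M * Real.exp (-b.re * r ^ 2) ≤ A := by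
      refine ⟨2 ^ M * (Real.exp b.re + M.factorial / b.re ^ M), fun r hr => ?_⟩
      have e0 : Real.exp (-b.re * r ^ 2) ≤ 1 := by
        rw [Real.exp_le_one_iff]
        nlinarith [sq_nonneg r]
      rcases le_total r 1 with h1 | h1
      · calc (1 + r) ^ M * Real.exp (-b.re * r ^ 2) ≤ 2 ^ M * 1 := by gcongr; linarith
          _ ≤ _ := by
            gcongr
            have : 1 ≤ Real.exp b.re := Real.one_le_exp hb.le
            have : 0 ≤ M.factorial / b.re ^ M := by positivity
            linarith
      · have h2 : r ^ M * Real.exp (-b.re * r ^ 2) ≤ M.factorial / b.re ^ M := by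
          have h3 := Real.pow_div_factorial_le_exp (b.re * r ^ 2) (by positivity) M
          have h4 : r ^ M ≤ (r ^ 2) ^ M := by gcongr; nlinarith
          rw [le_div_iff₀ (by positivity), neg_mul, Real.exp_neg, ← div_eq_mul_inv, div_mul_eq_mul_div,
            div_le_iff₀ (Real.exp_pos _)]
          rw [div_le_iff₀ (by positivity), mul_pow] at h3
          calc r ^ M * b.re ^ M ≤ (r ^ 2) ^ M * b.re ^ M := by gcongr
            _ ≤ _ := by linarith
        calc (1 + r) ^ M * Real.exp (-b.re * r ^ 2) ≤ (2 * r) ^ M * Real.exp (-b.re * r ^ 2) := by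
              gcongr; linarith
          _ = 2 ^ M * (r ^ M * Real.exp (-b.re * r ^ 2)) := by rw [mul_pow, mul_assoc]
          _ ≤ _ := by
            gcongr
            have : 0 ≤ Real.exp b.re := (Real.exp_pos _).le
            linarith
    refine ⟨n.factorial * (1 + ‖b‖) ^ n * (D + 1) ^ n * A, fun x => ?_⟩
    have hcomp := norm_iteratedFDeriv_comp_le (𝕜 := ℝ) (n := n) (N := (⊤ : ℕ∞)) hgs (contDiff_norm_sq ℝ)
      (mod_cast le_top) x
      (C := (1 + ‖b‖) ^ n * Real.exp (-b.re * ‖x‖ ^ 2)) (D := (D + 1) * (1 + ‖x‖) ^ m)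
      (fun i hi => by
        rw [hgd]
        gcongr
        calc ‖b‖ ^ i ≤ (1 + ‖b‖) ^ i := by gcongr; linarith [norm_nonneg b]
          _ ≤ (1 + ‖b‖) ^ n := pow_le_pow_right₀ (by linarith [norm_nonneg b]) hi)
      (fun i h1 hi => by
        refine (hN i hi x).trans ?_
        have e1 : 1 ≤ (1 + ‖x‖) ^ m := one_le_pow₀ (by linarith [norm_nonneg x])
        refine le_trans ?_ (le_self_pow₀ ?_ (by omega : i ≠ 0))
        · gcongr; linarith
        · nlinarith)
    have heq : g ∘ (fun x : V => ‖x‖ ^ 2) = fun x : V => Complex.exp (-b * (‖x‖ : ℂ) ^ 2) := by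
      ext x; simp [hg]
    rw [heq] at hcomp
    calc _ ≤ (1 + ‖x‖) ^ k * (n.factorial * ((1 + ‖b‖) ^ n * Real.exp (-b.re * ‖x‖ ^ 2)) *
          ((D + 1) * (1 + ‖x‖) ^ m) ^ n) := by
          gcongr
          linarith
      _ = n.factorial * (1 + ‖b‖) ^ n * (D + 1) ^ n *
          ((1 + ‖x‖) ^ M * Real.exp (-b.re * ‖x‖ ^ 2)) := by
          rw [hM, pow_add, pow_mul, mul_pow]
          generalize 1 + ‖x‖ = y
          ring
      _ ≤ _ := by
        gcongr
        exact hA _ (norm_nonneg _)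

theorem schwartzGaussian_apply {b : ℂ} (hb : 0 < b.re) (x : V) :
    schwartzGaussian V hb x = Complex.exp (-b * (‖x‖ : ℂ) ^ 2) := rfl

variable [FiniteDimensional ℝ V] [MeasurableSpace V] [BorelSpace V]

theorem fourier_schwartzGaussian {b : ℂ} (hb : 0 < b.re) (ξ : V) :
    𝓕 (⇑(schwartzGaussian V hb)) ξ =
      (Real.pi / b) ^ (finrank ℝ V / 2 : ℂ) * Complex.exp (-Real.pi ^ 2 * ‖ξ‖ ^ 2 / b) :=
  fourier_gaussian_innerProductSpace hb ξ

theorem norm_fourier_schwartzGaussian {b : ℂ} (hb : 0 < b.re) (ξ : V) :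
    ‖𝓕 (⇑(schwartzGaussian V hb)) ξ‖ =
      (Real.pi / ‖b‖) ^ (finrank ℝ V / 2 : ℝ) *
        Real.exp (-Real.pi ^ 2 * b.re / ‖b‖ ^ 2 * ‖ξ‖ ^ 2) := by
  have hb0 : b ≠ 0 := by rintro rfl; simp at hb
  rw [fourier_schwartzGaussian, norm_mul, Complex.norm_exp]
  congr 1
  · have : (finrank ℝ V / 2 : ℂ) = ((finrank ℝ V / 2 : ℝ) : ℂ) := by push_cast; rfl
    rw [this, Complex.norm_cpow_real, norm_div, Complex.norm_real,
      Real.norm_of_nonneg Real.pi_pos.le]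
  · congr 1
    have : (-(Real.pi : ℂ) ^ 2 * (‖ξ‖ : ℂ) ^ 2 / b) = ((-Real.pi ^ 2 * ‖ξ‖ ^ 2 : ℝ) : ℂ) * b⁻¹ := by
      push_cast; rw [div_eq_mul_inv]
    rw [this, Complex.re_ofReal_mul, Complex.inv_re, Complex.normSq_eq_norm_sq]
    ring

end Gaussian

variable {V : Type*} [NormedAddCommGroup V] [InnerProductSpace ℝ V] [FiniteDimensional ℝ V]
  [MeasurableSpace V] [BorelSpace V]

theorem memLp_norm_rpow_mul_norm (f : SchwartzMap V ℂ) {a : ℝ} (ha : 0 ≤ a) (q : ℝ≥0∞) :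
    MemLp (fun x => ‖x‖ ^ a * ‖f x‖) q := by
  have hg := Function.hasTemperateGrowth_one_add_norm_sq_rpow (H := V) (a / 2)
  have hm : MemLp (fun x => (1 + ‖x‖ ^ 2) ^ (a / 2) • f x) q := by
    have := (SchwartzMap.smulLeftCLM ℂ (fun x : V => (1 + ‖x‖ ^ 2) ^ (a / 2)) f).memLp
      (μ := volume) q
    rwa [SchwartzMap.smulLeftCLM_apply hg] at this
  refine hm.of_le
    ?_ (Eventually.of_forall fun x => ?_)
  · exact ((measurable_norm.pow_const _).mul f.continuous.measurable.norm).aestronglyMeasurable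
  · rw [norm_smul, norm_mul, norm_norm]
    gcongr
    rw [Real.norm_of_nonneg (by positivity), Real.norm_of_nonneg (by positivity)]
    calc ‖x‖ ^ a = (‖x‖ ^ 2) ^ (a / 2) := by
          rw [← Real.rpow_natCast, ← Real.rpow_mul (norm_nonneg _)]
          congr 1; push_cast; ring
      _ ≤ _ := by gcongr; linarith

theorem eLpNorm_comp_smul_of_pos {E : Type*} [NormedAddCommGroup E] {f : V → E}
    (hf : AEStronglyMeasurable f) {R : ℝ} (hR : 0 < R) (p : ℝ≥0∞) :
    eLpNorm (fun x => f (R • x)) p =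
      ENNReal.ofReal (R ^ (-(finrank ℝ V * p⁻¹.toReal))) * eLpNorm f p := by
  have hmap := Measure.map_addHaar_smul (volume : Measure V) hR.ne'
  have hc : ENNReal.ofReal |(R ^ finrank ℝ V)⁻¹| ≠ 0 := by
    have : 0 < |(R ^ finrank ℝ V)⁻¹| := by positivity
    simpa using this
  have h := eLpNorm_map_measure (μ := (volume : Measure V)) (p := p) (f := fun x => R • x) (g := f)
    (by rw [hmap]; exact hf.smul_measure _) (measurable_const_smul R).aemeasurable
  rw [hmap, eLpNorm_smul_measure_of_ne_zero hc] at h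
  rw [show (fun x => f (R • x)) = f ∘ fun x => R • x from rfl, ← h, smul_eq_mul, one_div]
  congr 1
  rw [ENNReal.ofReal_rpow_of_pos (by positivity), abs_of_pos (by positivity),
    ← Real.rpow_natCast, ← Real.rpow_neg hR.le, ← Real.rpow_mul hR.le, neg_mul]

theorem fourier_comp_smul (f : V → ℂ) {R : ℝ} (hR : 0 < R) (ξ : V) :
    𝓕 (fun x => f (R • x)) ξ = (R ^ (-(finrank ℝ V : ℝ)) : ℝ) * 𝓕 f (R⁻¹ • ξ) := by
  rw [Real.fourier_eq, Real.fourier_eq]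
  have h := Measure.integral_comp_smul (volume : Measure V)
    (fun v => 𝐞 (-inner ℝ v (R⁻¹ • ξ)) • f v) R
  have e : ∀ v : V, inner ℝ (R • v) (R⁻¹ • ξ) = inner ℝ v ξ := fun v => by
    rw [real_inner_smul_left, real_inner_smul_right, mul_inv_cancel_left₀ hR.ne']
  simp only [e] at h
  rw [h, abs_of_pos (by positivity), ← Real.rpow_natCast, ← Real.rpow_neg hR.le, Complex.real_smul]

end

section

variable {V : Type*} [NormedAddCommGroup V] [InnerProductSpace ℝ V] [FiniteDimensional ℝ V]
  [MeasurableSpace V] [BorelSpace V]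

/-- `C` is an admissible constant in the inequality
`‖f‖_q ≤ C (‖|x|^α f‖_q + ‖|ξ|^β f̂‖_p)` on Schwartz functions. -/
def IsHeisenbergConstant (V : Type*) [NormedAddCommGroup V] [InnerProductSpace ℝ V]
    [FiniteDimensional ℝ V] [MeasurableSpace V] [BorelSpace V] (p q : ℝ≥0∞) (α β C : ℝ) : Prop :=
  ∀ f : SchwartzMap V ℂ, eLpNorm f q ≤ ENNReal.ofReal C *
    (eLpNorm (fun x => ‖x‖ ^ α * ‖f x‖) q + eLpNorm (fun ξ => ‖ξ‖ ^ β * ‖𝓕 (⇑f) ξ‖) p)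

theorem eLpNorm_norm_rpow_mul_comp_smul {g : V → ℂ} (hg : Continuous g) (a : ℝ) {R : ℝ}
    (hR : 0 < R) (p : ℝ≥0∞) :
    eLpNorm (fun x => ‖x‖ ^ a * ‖g (R • x)‖) p =
      ENNReal.ofReal (R ^ (-a - finrank ℝ V * p⁻¹.toReal)) *
        eLpNorm (fun x => ‖x‖ ^ a * ‖g x‖) p := by
  have h : (fun x : V => ‖x‖ ^ a * ‖g (R • x)‖) =
      R ^ (-a) • fun x : V => ‖R • x‖ ^ a * ‖g (R • x)‖ := by
    ext x
    rw [Pi.smul_apply, smul_eq_mul, norm_smul, Real.norm_of_nonneg hR.le,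
      Real.mul_rpow hR.le (norm_nonneg _), ← mul_assoc, ← mul_assoc, ← Real.rpow_add hR,
      neg_add_cancel, Real.rpow_zero, one_mul]
  have hm : AEStronglyMeasurable (fun x : V => ‖x‖ ^ a * ‖g x‖) :=
    ((measurable_norm.pow_const _).mul hg.measurable.norm).aestronglyMeasurable
  rw [h, eLpNorm_const_smul, eLpNorm_comp_smul_of_pos hm hR, ← mul_assoc,
    Real.enorm_of_nonneg (by positivity), ← ENNReal.ofReal_mul (by positivity), ← Real.rpow_add hR]
  rfl

theorem continuous_fourier_schwartz (f : SchwartzMap V ℂ) : Continuous (𝓕 (⇑f)) := by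
  rw [← SchwartzMap.fourier_coe]; exact (𝓕 f).continuous

theorem IsHeisenbergConstant.scale {p q : ℝ≥0∞} {α β C : ℝ} (h : IsHeisenbergConstant V p q α β C)
    (f : SchwartzMap V ℂ) {R : ℝ} (hR : 0 < R) :
    eLpNorm f q ≤ ENNReal.ofReal C *
      (ENNReal.ofReal (R ^ (-α)) * eLpNorm (fun x => ‖x‖ ^ α * ‖f x‖) q +
        ENNReal.ofReal (R ^ (β - finrank ℝ V * (1 - q⁻¹.toReal - p⁻¹.toReal))) *
          eLpNorm (fun ξ => ‖ξ‖ ^ β * ‖𝓕 (⇑f) ξ‖) p) := by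
  set n : ℝ := (finrank ℝ V : ℝ)
  set fR : SchwartzMap V ℂ := SchwartzMap.compCLMOfContinuousLinearEquiv ℝ
    (ContinuousLinearEquiv.smulLeft (Units.mk0 R hR.ne')) f
  have hfR : (⇑fR : V → ℂ) = fun x => f (R • x) := rfl
  have hF : 𝓕 (⇑fR) = fun ξ => (R ^ (-n) : ℝ) * 𝓕 (⇑f) (R⁻¹ • ξ) := by
    ext ξ
    rw [hfR, fourier_comp_smul _ hR]
  have h2 : eLpNorm (fun ξ => ‖ξ‖ ^ β * ‖𝓕 (⇑fR) ξ‖) p =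
      ENNReal.ofReal (R ^ (-n + (β + n * p⁻¹.toReal))) *
        eLpNorm (fun ξ => ‖ξ‖ ^ β * ‖𝓕 (⇑f) ξ‖) p := by
    have e : (fun ξ : V => ‖ξ‖ ^ β * ‖𝓕 (⇑fR) ξ‖) =
        R ^ (-n) • fun ξ : V => ‖ξ‖ ^ β * ‖𝓕 (⇑f) (R⁻¹ • ξ)‖ := by
      ext ξ
      rw [hF, norm_mul, Complex.norm_real, Real.norm_of_nonneg (by positivity), Pi.smul_apply,
        smul_eq_mul]
      ring
    rw [e, eLpNorm_const_smul,
      eLpNorm_norm_rpow_mul_comp_smul (continuous_fourier_schwartz f) β (inv_pos.2 hR),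
      Real.enorm_of_nonneg (by positivity), ← mul_assoc, ← ENNReal.ofReal_mul (by positivity),
      ← Real.rpow_neg_one, ← Real.rpow_mul hR.le, ← Real.rpow_add hR]
    congr 3
    ring
  have h3 := h fR
  rw [h2, hfR, eLpNorm_norm_rpow_mul_comp_smul f.continuous α hR,
    eLpNorm_comp_smul_of_pos f.continuous.aestronglyMeasurable hR] at h3
  have hc : ENNReal.ofReal (R ^ (n * q⁻¹.toReal)) * ENNReal.ofReal (R ^ (-(n * q⁻¹.toReal))) = 1 := by
    rw [← ENNReal.ofReal_mul (by positivity), ← Real.rpow_add hR, add_neg_cancel, Real.rpow_zero,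
      ENNReal.ofReal_one]
  have e1 : ENNReal.ofReal (R ^ (-α)) = ENNReal.ofReal (R ^ (n * q⁻¹.toReal)) *
      ENNReal.ofReal (R ^ (-α - n * q⁻¹.toReal)) := by
    rw [← ENNReal.ofReal_mul (by positivity), ← Real.rpow_add hR]
    congr 2
    ring
  have e2 : ENNReal.ofReal (R ^ (β - n * (1 - q⁻¹.toReal - p⁻¹.toReal))) =
      ENNReal.ofReal (R ^ (n * q⁻¹.toReal)) *
        ENNReal.ofReal (R ^ (-n + (β + n * p⁻¹.toReal))) := by
    rw [← ENNReal.ofReal_mul (by positivity), ← Real.rpow_add hR]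
    congr 2
    ring
  rw [← one_mul (eLpNorm f q volume), ← hc, e1, e2, mul_assoc]
  refine (mul_le_mul_right h3 _).trans_eq ?_
  generalize ENNReal.ofReal (R ^ (n * q⁻¹.toReal)) = a
  rw [mul_left_comm, mul_add, mul_assoc a, mul_assoc a]

/-- Letting the scaling parameter tend to infinity. -/
theorem tendsto_ofReal_rpow_neg_mul {a : ℝ} (ha : 0 < a) {X : ℝ≥0∞} (hX : X ≠ ∞) :
    Tendsto (fun R : ℝ => ENNReal.ofReal (R ^ (-a)) * X) atTop (𝓝 0) := by
  have h := ENNReal.tendsto_ofReal (tendsto_rpow_neg_atTop ha)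
  rw [ENNReal.ofReal_zero] at h
  simpa using ENNReal.Tendsto.mul_const h (Or.inr hX)

theorem IsHeisenbergConstant.eLpNorm_le_of_eq {p q : ℝ≥0∞} {α β C : ℝ} (hα : 0 < α)
    (h : IsHeisenbergConstant V p q α β C)
    (hβ : β = finrank ℝ V * (1 - q⁻¹.toReal - p⁻¹.toReal)) (f : SchwartzMap V ℂ) :
    eLpNorm f q ≤ ENNReal.ofReal C * eLpNorm (fun ξ => ‖ξ‖ ^ β * ‖𝓕 (⇑f) ξ‖) p := by
  have ht := tendsto_ofReal_rpow_neg_mul hα (memLp_norm_rpow_mul_norm f hα.le q).eLpNorm_ne_top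
  have ht2 := ENNReal.Tendsto.const_mul (a := ENNReal.ofReal C)
    (ht.add (tendsto_const_nhds (x := eLpNorm (fun ξ => ‖ξ‖ ^ β * ‖𝓕 (⇑f) ξ‖) p)))
    (Or.inr ENNReal.ofReal_ne_top)
  rw [zero_add] at ht2
  refine ge_of_tendsto ht2 ?_
  filter_upwards [eventually_gt_atTop 0] with R hR
  have := h.scale f hR
  rwa [← hβ, sub_self, Real.rpow_zero, ENNReal.ofReal_one, one_mul] at this

theorem eLpNorm_schwartzGaussian_pos {b : ℂ} (hb : 0 < b.re) {q : ℝ≥0∞} (hq : q ≠ 0) :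
    0 < eLpNorm (schwartzGaussian V hb) q := by
  rw [pos_iff_ne_zero, Ne, eLpNorm_eq_zero_iff
    (schwartzGaussian V hb).continuous.aestronglyMeasurable hq]
  intro h
  have h0 := (schwartzGaussian V hb).continuous.ae_eq_iff_eq volume continuous_zero |>.1 h
  have := congrFun h0 0
  simp [schwartzGaussian_apply] at this

theorem IsHeisenbergConstant.le_exponent {p q : ℝ≥0∞} (hq : q ≠ 0) {α β C : ℝ} (hα : 0 < α)
    (hβ : 0 < β) (h : IsHeisenbergConstant V p q α β C) :
    finrank ℝ V * (1 - q⁻¹.toReal - p⁻¹.toReal) ≤ β := by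
  by_contra! hlt
  set f := schwartzGaussian V (b := 1) (by simp)
  have ht := tendsto_ofReal_rpow_neg_mul hα (memLp_norm_rpow_mul_norm f hα.le q).eLpNorm_ne_top
  have hY : eLpNorm (fun ξ => ‖ξ‖ ^ β * ‖𝓕 (⇑f) ξ‖) p ≠ ∞ := by
    rw [← SchwartzMap.fourier_coe]
    exact (memLp_norm_rpow_mul_norm (𝓕 f) hβ.le p).eLpNorm_ne_top
  have ht' := tendsto_ofReal_rpow_neg_mul (sub_pos.2 hlt) hY
  have ht2 := ENNReal.Tendsto.const_mul (a := ENNReal.ofReal C) (ht.add ht')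
    (Or.inr ENNReal.ofReal_ne_top)
  rw [zero_add, mul_zero] at ht2
  refine (eLpNorm_schwartzGaussian_pos (V := V) (b := 1) (by simp) hq).not_ge
    (ge_of_tendsto ht2 ?_)
  filter_upwards [eventually_gt_atTop 0] with R hR
  have := h.scale f hR
  rwa [← neg_sub _ β] at this

end

section

section Bump

/-- The profile `s ^ c * exp (-π s²)`. -/
noncomputable def bump (c s : ℝ) : ℝ := s ^ c * Real.exp (-Real.pi * s ^ 2)

theorem bump_nonneg {c s : ℝ} (hs : 0 ≤ s) : 0 ≤ bump c s := by
  unfold bump; positivity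

theorem exists_bump_le {c : ℝ} (hc : 0 < c) :
    ∃ A : ℝ, 0 < A ∧ ∀ s : ℝ, 0 < s → bump c s ≤ A * (s ^ c / (1 + s ^ c) ^ 2) := by
  obtain ⟨m, hm⟩ := exists_nat_ge c
  refine ⟨4 + 2 * m.factorial, by positivity, fun s hs => ?_⟩
  have hsc : 0 < s ^ c := by positivity
  have h1 : s ^ c * s ^ c ≤ 1 + (s ^ 2) ^ m := by
    rcases le_total s 1 with h | h
    · have : s ^ c ≤ 1 := Real.rpow_le_one hs.le h hc.le
      have : 0 ≤ (s ^ 2) ^ m := by positivity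
      nlinarith
    · have : s ^ c ≤ s ^ m := by
        rw [← Real.rpow_natCast]; exact Real.rpow_le_rpow_of_exponent_le h hm
      have e : (s ^ 2) ^ m = s ^ m * s ^ m := by rw [← mul_pow, sq]
      rw [e]
      nlinarith
  have h2 : (s ^ 2) ^ m ≤ m.factorial * Real.exp (Real.pi * s ^ 2) := by
    have h3 := Real.pow_div_factorial_le_exp (Real.pi * s ^ 2) (by positivity) m
    rw [div_le_iff₀ (by positivity)] at h3
    have h4 : (s ^ 2) ^ m ≤ (Real.pi * s ^ 2) ^ m := by
      gcongr
      exact le_mul_of_one_le_left (by positivity) (by linarith [Real.pi_gt_three])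
    linarith
  have h5 : 1 ≤ Real.exp (Real.pi * s ^ 2) := Real.one_le_exp (by positivity)
  have h6 : (1 + s ^ c) ^ 2 ≤ (4 + 2 * m.factorial) * Real.exp (Real.pi * s ^ 2) := by
    nlinarith [sq_nonneg (1 - s ^ c)]
  rw [bump, neg_mul, Real.exp_neg, mul_div_left_comm]
  refine mul_le_mul_of_nonneg_left ?_ hsc.le
  rw [inv_eq_one_div, div_le_div_iff₀ (Real.exp_pos _) (by positivity)]
  linarith

theorem exists_sum_bump_le {c : ℝ} (hc : 0 < c) :
    ∃ S : ℝ, 0 < S ∧ ∀ (n : ℕ) (s : ℝ), 0 < s →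
      ∑ k ∈ Finset.range n, bump c (s / 2 ^ k) ≤ S := by
  obtain ⟨A, hA, h⟩ := exists_bump_le hc
  set r : ℝ := 2 ^ c with hr
  have hr1 : 1 < r := Real.one_lt_rpow (by norm_num) hc
  have hr0 : 0 < 1 - r⁻¹ := sub_pos.2 (inv_lt_one_of_one_lt₀ hr1)
  set φ : ℝ → ℝ := fun t => t / (1 + t) with hφ
  have hstep : ∀ t : ℝ, 0 < t → (1 - r⁻¹) * (t / (1 + t) ^ 2) ≤ φ t - φ (t / r) := by
    intro t ht
    have e : φ t - φ (t / r) = (1 - r⁻¹) * (t / ((1 + t) * (1 + t / r))) := by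
      simp only [hφ]
      field_simp
      ring
    rw [e]
    have : t / r ≤ t := div_le_self ht.le hr1.le
    gcongr
    rw [sq]
    gcongr
  refine ⟨A * (1 / (1 - r⁻¹)), by positivity, fun n s hs => ?_⟩
  have hk : ∀ k : ℕ, bump c (s / 2 ^ k) ≤
      A / (1 - r⁻¹) * (φ (s ^ c / r ^ k) - φ (s ^ c / r ^ (k + 1))) := by
    intro k
    have e : (s / 2 ^ k) ^ c = s ^ c / r ^ k := by
      rw [Real.div_rpow hs.le (by positivity), hr, ← Real.rpow_natCast, ← Real.rpow_natCast,
        ← Real.rpow_mul (by norm_num), ← Real.rpow_mul (by norm_num), mul_comm]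
    have h1 := h (s / 2 ^ k) (by positivity)
    rw [e] at h1
    have h2 := hstep (s ^ c / r ^ k) (by positivity)
    refine h1.trans ?_
    rw [pow_succ r, ← div_div (s ^ c), div_eq_mul_inv A, mul_assoc]
    refine mul_le_mul_of_nonneg_left ?_ hA.le
    rwa [inv_mul_eq_div, le_div_iff₀ hr0, mul_comm]
  have hφ1 : φ (s ^ c / r ^ 0) ≤ 1 := by
    simp only [hφ]
    rw [div_le_one (by positivity)]
    linarith
  have hφ0 : 0 ≤ φ (s ^ c / r ^ n) := by simp only [hφ]; positivity
  calc ∑ k ∈ Finset.range n, bump c (s / 2 ^ k)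
      ≤ ∑ k ∈ Finset.range n, A / (1 - r⁻¹) * (φ (s ^ c / r ^ k) - φ (s ^ c / r ^ (k + 1))) :=
        Finset.sum_le_sum fun k _ => hk k
    _ = A / (1 - r⁻¹) * (φ (s ^ c / r ^ 0) - φ (s ^ c / r ^ n)) := by
        rw [← Finset.mul_sum, Finset.sum_range_sub']
    _ ≤ A / (1 - r⁻¹) * 1 := by gcongr; linarith
    _ = _ := by ring

end Bump

variable {V : Type*} [NormedAddCommGroup V] [InnerProductSpace ℝ V] [FiniteDimensional ℝ V]
  [MeasurableSpace V] [BorelSpace V]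

theorem lintegral_norm_rpow_neg_mul_bump_lt_top [Nontrivial V] {c : ℝ} (hc : 0 < c) :
    ∫⁻ ξ : V, ENNReal.ofReal (‖ξ‖ ^ (-(finrank ℝ V : ℝ)) * bump c ‖ξ‖) < ∞ := by
  set n : ℝ := (finrank ℝ V : ℝ)
  obtain ⟨A, hA, h⟩ := exists_bump_le hc
  obtain ⟨C₁, -, h1⟩ := exists_setLIntegral_norm_rpow_le (V := V) (a := n - c) (by linarith)
  obtain ⟨C₂, -, h2⟩ := exists_setLIntegral_norm_rpow_le_of_gt (V := V) (a := n + c) (by linarith)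
  have huniv : (univ : Set V) = {ξ | ‖ξ‖ ≤ 1} ∪ {ξ | 1 ≤ ‖ξ‖} := by
    ext ξ; simp [le_total]
  have b1 : ∫⁻ ξ in {ξ : V | ‖ξ‖ ≤ 1}, ENNReal.ofReal (‖ξ‖ ^ (-n) * bump c ‖ξ‖) < ∞ := by
    refine lt_of_le_of_lt (lintegral_mono_ae ?_) ((h1 1 one_pos).trans_lt ENNReal.ofReal_lt_top)
    filter_upwards [ae_restrict_of_ae (ae_norm_pos (V := V))] with ξ hξ
    apply ENNReal.ofReal_le_ofReal
    rw [bump, ← mul_assoc, ← Real.rpow_add hξ, neg_sub, neg_add_eq_sub]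
    refine mul_le_of_le_one_right (by positivity) (Real.exp_le_one_iff.2 ?_)
    nlinarith [Real.pi_pos, sq_nonneg ‖ξ‖]
  have b2 : ∫⁻ ξ in {ξ : V | 1 ≤ ‖ξ‖}, ENNReal.ofReal (‖ξ‖ ^ (-n) * bump c ‖ξ‖) < ∞ := by
    refine lt_of_le_of_lt (lintegral_mono_ae (g := fun ξ =>
      ENNReal.ofReal A * ENNReal.ofReal (‖ξ‖ ^ (-(n + c)))) ?_) ?_
    · filter_upwards [ae_restrict_of_ae (ae_norm_pos (V := V))] with ξ hξ
      rw [← ENNReal.ofReal_mul hA.le]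
      apply ENNReal.ofReal_le_ofReal
      have e : ‖ξ‖ ^ c / (1 + ‖ξ‖ ^ c) ^ 2 ≤ ‖ξ‖ ^ (-c) := by
        have : 0 < ‖ξ‖ ^ c := by positivity
        rw [Real.rpow_neg hξ.le, inv_eq_one_div, div_le_div_iff₀ (by positivity) (by positivity)]
        nlinarith
      calc ‖ξ‖ ^ (-n) * bump c ‖ξ‖ ≤ ‖ξ‖ ^ (-n) * (A * ‖ξ‖ ^ (-c)) := by
            gcongr
            exact (h _ hξ).trans (by gcongr)
        _ = A * (‖ξ‖ ^ (-n) * ‖ξ‖ ^ (-c)) := by ring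
        _ = _ := by rw [← Real.rpow_add hξ, neg_add]
    · rw [lintegral_const_mul' _ _ ENNReal.ofReal_ne_top]
      exact ENNReal.mul_lt_top ENNReal.ofReal_lt_top
        ((h2 1 one_pos).trans_lt ENNReal.ofReal_lt_top)
  rw [← setLIntegral_univ, huniv]
  exact (lintegral_union_le _ _ _).trans_lt (ENNReal.add_lt_top.2 ⟨b1, b2⟩)

theorem lintegral_norm_rpow_neg_mul_bump_div (c : ℝ) {R : ℝ} (hR : 0 < R) :
    ∫⁻ ξ : V, ENNReal.ofReal (‖ξ‖ ^ (-(finrank ℝ V : ℝ)) * bump c (‖ξ‖ / R)) =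
      ∫⁻ ξ : V, ENNReal.ofReal (‖ξ‖ ^ (-(finrank ℝ V : ℝ)) * bump c ‖ξ‖) := by
  set n : ℝ := (finrank ℝ V : ℝ)
  have h := lintegral_comp_smul_of_pos
    (fun ξ : V => ENNReal.ofReal (‖ξ‖ ^ (-n) * bump c ‖ξ‖)) (inv_pos.2 hR)
  have e : ∀ ξ : V, ENNReal.ofReal (‖R⁻¹ • ξ‖ ^ (-n) * bump c ‖R⁻¹ • ξ‖) =
      ENNReal.ofReal (R⁻¹ ^ (-n)) * ENNReal.ofReal (‖ξ‖ ^ (-n) * bump c (‖ξ‖ / R)) := by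
    intro ξ
    rw [← ENNReal.ofReal_mul (by positivity), norm_smul, Real.norm_of_nonneg (by positivity),
      Real.mul_rpow (by positivity) (norm_nonneg _), mul_assoc, inv_mul_eq_div]
  simp only [e] at h
  rw [lintegral_const_mul' _ _ ENNReal.ofReal_ne_top] at h
  refine (ENNReal.mul_right_inj ?_ ENNReal.ofReal_ne_top).1 h
  have : 0 < R⁻¹ ^ (-n) := by positivity
  simpa using this

/-- A sum of `n` dyadically rescaled Gaussians, normalised so that the weighted `L^p` norms of the
summands are comparable, has weighted norm `O(n ^ (1 / p))`. -/
theorem exists_eLpNorm_dyadic_le [Nontrivial V] {p : ℝ≥0∞} (hp : 1 ≤ p) {β a : ℝ} (hβ : 0 < β)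
    (ha : a + β + finrank ℝ V * p⁻¹.toReal ≤ 0) :
    ∃ C : ℝ, 0 < C ∧ ∀ (n : ℕ) (F : V → ℂ),
      (∀ ξ, ‖F ξ‖ ≤ ∑ k ∈ Finset.range n,
        (2 : ℝ) ^ (k * a) * Real.exp (-Real.pi * (‖ξ‖ / 2 ^ k) ^ 2)) →
      eLpNorm (fun ξ => ‖ξ‖ ^ β * ‖F ξ‖) p ≤ ENNReal.ofReal (C * (n : ℝ) ^ p⁻¹.toReal) := by
  set d : ℝ := (finrank ℝ V : ℝ)
  have hd : 0 ≤ d := Nat.cast_nonneg _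
  set σ := p⁻¹.toReal with hσ
  have hσ0 : 0 ≤ σ := ENNReal.toReal_nonneg
  set c := β + d * σ with hc
  have hc0 : 0 < c := by positivity
  obtain ⟨S, hS, hsum⟩ := exists_sum_bump_le hc0
  have hpt : ∀ (n : ℕ) (F : V → ℂ), (∀ ξ, ‖F ξ‖ ≤ ∑ k ∈ Finset.range n,
      (2 : ℝ) ^ (k * a) * Real.exp (-Real.pi * (‖ξ‖ / 2 ^ k) ^ 2)) → ∀ ξ : V, 0 < ‖ξ‖ →
      ‖ξ‖ ^ β * ‖F ξ‖ ≤ ‖ξ‖ ^ (-(d * σ)) * ∑ k ∈ Finset.range n, bump c (‖ξ‖ / 2 ^ k) := by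
    intro n F hF ξ hξ
    refine (mul_le_mul_of_nonneg_left (hF ξ) (by positivity)).trans ?_
    rw [Finset.mul_sum, Finset.mul_sum]
    refine Finset.sum_le_sum fun k _ => ?_
    rw [bump, ← mul_assoc, ← mul_assoc]
    refine mul_le_mul_of_nonneg_right ?_ (Real.exp_pos _).le
    rw [Real.div_rpow hξ.le (by positivity), ← mul_div_assoc, ← Real.rpow_add hξ, hc,
      neg_add_cancel_comm_assoc, div_eq_mul_inv, ← Real.rpow_natCast,
      ← Real.rpow_mul (by norm_num), ← Real.rpow_neg (by norm_num)]
    gcongr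
    · norm_num
    · rw [← mul_neg]
      gcongr
      linarith
  rcases eq_or_ne p ∞ with rfl | hpt'
  · refine ⟨S, hS, fun n F hF => ?_⟩
    have h0 : σ = 0 := by simp [hσ]
    rw [h0, Real.rpow_zero, mul_one, eLpNorm_exponent_top]
    refine eLpNormEssSup_le_of_ae_bound ?_
    filter_upwards [ae_norm_pos (V := V)] with ξ hξ
    rw [Real.norm_of_nonneg (by positivity)]
    refine (hpt n F hF ξ hξ).trans ?_
    rw [h0, mul_zero, neg_zero, Real.rpow_zero, one_mul]
    exact hsum n _ hξ
  set P := p.toReal with hP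
  have hP1 : 1 ≤ P := by
    rw [hP, ← ENNReal.toReal_one]; exact ENNReal.toReal_mono hpt' hp
  have hσP : σ = 1 / P := by rw [hσ, ENNReal.toReal_inv, one_div]
  have hI := lintegral_norm_rpow_neg_mul_bump_lt_top (V := V) hc0
  set I := ∫⁻ ξ : V, ENNReal.ofReal (‖ξ‖ ^ (-d) * bump c ‖ξ‖) with hIdef
  refine ⟨(S ^ (P - 1) * I.toReal) ^ σ + 1, by positivity, fun n F hF => ?_⟩
  have h_rpow : ∫⁻ ξ, ‖‖ξ‖ ^ β * ‖F ξ‖‖ₑ ^ P ≤ ENNReal.ofReal (S ^ (P - 1) * I.toReal * n) := by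
    calc ∫⁻ ξ, ‖‖ξ‖ ^ β * ‖F ξ‖‖ₑ ^ P
        ≤ ∫⁻ ξ : V, ENNReal.ofReal (S ^ (P - 1)) * ∑ k ∈ Finset.range n,
            ENNReal.ofReal (‖ξ‖ ^ (-d) * bump c (‖ξ‖ / 2 ^ k)) := by
          refine lintegral_mono_ae ?_
          filter_upwards [ae_norm_pos (V := V)] with ξ hξ
          have hb : ∀ k : ℕ, 0 ≤ bump c (‖ξ‖ / 2 ^ k) := fun k => bump_nonneg (by positivity)
          have hT0 : 0 ≤ ∑ k ∈ Finset.range n, bump c (‖ξ‖ / 2 ^ k) :=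
            Finset.sum_nonneg fun k _ => hb k
          rw [Real.enorm_of_nonneg (by positivity),
            ENNReal.ofReal_rpow_of_nonneg (by positivity) (by positivity),
            ← ENNReal.ofReal_sum_of_nonneg (fun k _ => mul_nonneg (by positivity) (hb k)),
            ← ENNReal.ofReal_mul (by positivity), ← Finset.mul_sum]
          apply ENNReal.ofReal_le_ofReal
          set T := ∑ k ∈ Finset.range n, bump c (‖ξ‖ / 2 ^ k) with hT
          calc (‖ξ‖ ^ β * ‖F ξ‖) ^ P ≤ (‖ξ‖ ^ (-(d * σ)) * T) ^ P := by
                exact Real.rpow_le_rpow (by positivity) (hpt n F hF ξ hξ) (by positivity)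
            _ = ‖ξ‖ ^ (-d) * T ^ P := by
                rw [Real.mul_rpow (by positivity) hT0, ← Real.rpow_mul hξ.le, neg_mul, mul_assoc,
                  hσP, one_div_mul_cancel (by positivity), mul_one]
            _ = ‖ξ‖ ^ (-d) * (T ^ (P - 1) * T) := by
                rcases hT0.eq_or_lt with h0 | h0
                · rw [← h0, mul_zero, Real.zero_rpow (by positivity)]
                · rw [← Real.rpow_add_one h0.ne', sub_add_cancel]
            _ ≤ ‖ξ‖ ^ (-d) * (S ^ (P - 1) * T) := by
                have := hsum n _ hξ
                gcongr
            _ = _ := by ring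
      _ = ENNReal.ofReal (S ^ (P - 1)) * (n * I) := by
          rw [lintegral_const_mul' _ _ ENNReal.ofReal_ne_top, lintegral_finsetSum]
          · rw [Finset.sum_congr rfl fun k _ =>
              lintegral_norm_rpow_neg_mul_bump_div (V := V) c (pow_pos two_pos k), Finset.sum_const, Finset.card_range, nsmul_eq_mul]
          · intro k _
            unfold bump
            fun_prop
      _ = _ := by
          rw [ENNReal.ofReal_mul (by positivity), ENNReal.ofReal_mul (by positivity),
            ENNReal.ofReal_toReal hI.ne, ENNReal.ofReal_natCast, mul_assoc, mul_comm I]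
  rw [eLpNorm_eq_lintegral_rpow_enorm_toReal (one_pos.trans_le hp).ne' hpt', ← hP, ← hσP]
  refine (ENNReal.rpow_le_rpow h_rpow hσ0).trans ?_
  rw [ENNReal.ofReal_rpow_of_nonneg (by positivity) hσ0]
  apply ENNReal.ofReal_le_ofReal
  rw [Real.mul_rpow (by positivity) (by positivity)]
  gcongr
  linarith

end

section

variable {V : Type*} [NormedAddCommGroup V] [InnerProductSpace ℝ V] [FiniteDimensional ℝ V]
  [MeasurableSpace V] [BorelSpace V]

theorem norm_fourier_sum_smul_le (s : Finset ℕ) (c : ℕ → ℂ) (g : ℕ → SchwartzMap V ℂ) (ξ : V) :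
    ‖𝓕 (⇑(∑ k ∈ s, c k • g k)) ξ‖ ≤ ∑ k ∈ s, ‖c k‖ * ‖𝓕 (⇑(g k)) ξ‖ := by
  have h : 𝓕 (∑ k ∈ s, c k • g k) = ∑ k ∈ s, c k • 𝓕 (g k) := by simp
  rw [← SchwartzMap.fourier_coe, h]
  have e : (∑ k ∈ s, c k • 𝓕 (g k)) ξ = ∑ k ∈ s, c k * 𝓕 (⇑(g k)) ξ := by
    simp [SchwartzMap.fourier_coe]
  rw [e]
  exact (norm_sum_le _ _).trans_eq (Finset.sum_congr rfl fun k _ => norm_mul _ _)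

theorem enorm_le_eLpNorm_top {f : V → ℂ} (hf : Continuous f) (x : V) : ‖f x‖ₑ ≤ eLpNorm f ∞ := by
  have h : ∀ᵐ y, ‖f y‖ₑ ≤ eLpNorm f ∞ := by
    rw [eLpNorm_exponent_top]; exact enorm_ae_le_eLpNormEssSup f volume
  exact (isClosed_le hf.enorm continuous_const).closure_subset_iff.2 subset_rfl
    (Measure.dense_of_ae h x)

theorem sum_rpow_le_rpow_sum {r : ℝ} (hr : 1 ≤ r) (s : Finset ℕ) (a : ℕ → ℝ≥0∞) :
    ∑ k ∈ s, a k ^ r ≤ (∑ k ∈ s, a k) ^ r := by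
  induction s using Finset.cons_induction with
  | empty => simp
  | cons i s hi ih =>
    rw [Finset.sum_cons, Finset.sum_cons]
    exact (add_le_add_right ih _).trans (ENNReal.add_rpow_le_rpow_add _ _ hr)

theorem not_forall_natCast_rpow_mul_le {s t K : ℝ} (hst : s < t) {g : ℝ≥0∞} (hg : g ≠ 0) :
    ¬ ∀ n : ℕ, ENNReal.ofReal ((n : ℝ) ^ t) * g ≤ ENNReal.ofReal (K * (n : ℝ) ^ s) := by
  intro h
  obtain ⟨g', hg', hgg⟩ := ENNReal.lt_iff_exists_nnreal_btwn.1 (pos_iff_ne_zero.2 hg)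
  have hg0 : 0 < (g' : ℝ) := by exact_mod_cast hg'
  obtain ⟨n, hn, hn1⟩ := ((((tendsto_rpow_atTop (sub_pos.2 hst)).comp
    tendsto_natCast_atTop_atTop).eventually_gt_atTop (K / g')).and (eventually_ge_atTop 1)).exists
  have hn0 : 0 < (n : ℝ) := by exact_mod_cast hn1
  have h1 : ENNReal.ofReal ((n : ℝ) ^ t * g') ≤ ENNReal.ofReal (K * (n : ℝ) ^ s) := by
    rw [ENNReal.ofReal_mul (by positivity), ENNReal.ofReal_coe_nnreal]
    exact (mul_le_mul_right hgg.le _).trans (h n)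
  have hlt : K * (n : ℝ) ^ s < (n : ℝ) ^ t * g' := by
    simp only [Function.comp_apply] at hn
    rw [div_lt_iff₀ hg0, Real.rpow_sub hn0, div_mul_eq_mul_div, lt_div_iff₀ (by positivity)] at hn
    exact hn
  exact absurd h1 (not_le.2 ((ENNReal.ofReal_lt_ofReal_iff (by positivity)).2 hlt))

/-- The Gaussian `x ↦ exp (-π ‖2 ^ k x‖²)`. -/
noncomputable def dilatedGaussian (V : Type*) [NormedAddCommGroup V] [InnerProductSpace ℝ V]
    (k : ℕ) : SchwartzMap V ℂ :=
  schwartzGaussian V (b := ((Real.pi * 4 ^ k : ℝ) : ℂ)) (by rw [Complex.ofReal_re]; positivity)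

theorem dilatedGaussian_apply (k : ℕ) (x : V) :
    dilatedGaussian V k x = (Real.exp (-Real.pi * (2 ^ k * ‖x‖) ^ 2) : ℝ) := by
  rw [dilatedGaussian, schwartzGaussian_apply, Complex.ofReal_exp]
  congr 1
  push_cast
  rw [mul_pow, ← pow_mul, mul_comm k 2, pow_mul]
  norm_num
  ring

theorem norm_fourier_dilatedGaussian (k : ℕ) (ξ : V) :
    ‖𝓕 (⇑(dilatedGaussian V k)) ξ‖ =
      (2 : ℝ) ^ (-(k * (finrank ℝ V : ℝ))) * Real.exp (-Real.pi * (‖ξ‖ / 2 ^ k) ^ 2) := by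
  rw [dilatedGaussian, norm_fourier_schwartzGaussian, Complex.ofReal_re, Complex.norm_real,
    Real.norm_of_nonneg (by positivity)]
  have h4 : (4 : ℝ) ^ k = (2 ^ k) ^ 2 := by rw [← pow_mul, mul_comm, pow_mul]; norm_num
  congr 1
  · rw [div_mul_cancel_left₀ Real.pi_ne_zero, h4, ← Real.rpow_natCast, ← Real.rpow_natCast,
      ← Real.rpow_mul (by positivity), ← Real.rpow_neg (by positivity),
      ← Real.rpow_mul (by positivity)]
    congr 1
    push_cast
    ring
  · congr 1
    rw [h4]
    field_simp

/-- The test functions `∑ k < n, 2 ^ (k d τ) exp (-π ‖2 ^ k x‖²)`. -/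
noncomputable def gaussianSeries (V : Type*) [NormedAddCommGroup V] [InnerProductSpace ℝ V]
    (τ : ℝ) (n : ℕ) : SchwartzMap V ℂ :=
  ∑ k ∈ Finset.range n, (((2 : ℝ) ^ (k * (finrank ℝ V * τ)) : ℝ) : ℂ) • dilatedGaussian V k

theorem gaussianSeries_apply (τ : ℝ) (n : ℕ) (x : V) :
    gaussianSeries V τ n x = ((∑ k ∈ Finset.range n, (2 : ℝ) ^ (k * (finrank ℝ V * τ)) *
      Real.exp (-Real.pi * (2 ^ k * ‖x‖) ^ 2) : ℝ) : ℂ) := by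
  simp [gaussianSeries, dilatedGaussian_apply]

theorem norm_fourier_gaussianSeries_le (τ : ℝ) (n : ℕ) (ξ : V) :
    ‖𝓕 (⇑(gaussianSeries V τ n)) ξ‖ ≤ ∑ k ∈ Finset.range n,
      (2 : ℝ) ^ (k * (finrank ℝ V * (τ - 1))) * Real.exp (-Real.pi * (‖ξ‖ / 2 ^ k) ^ 2) := by
  refine (norm_fourier_sum_smul_le _ _ _ ξ).trans_eq (Finset.sum_congr rfl fun k _ => ?_)
  rw [norm_fourier_dilatedGaussian, Complex.norm_real, Real.norm_of_nonneg (by positivity),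
    ← mul_assoc, ← Real.rpow_add (by norm_num)]
  congr 2
  ring

theorem eLpNorm_dilatedGaussian (q : ℝ≥0∞) (k : ℕ) :
    ENNReal.ofReal ((2 : ℝ) ^ (k * (finrank ℝ V * q⁻¹.toReal))) * eLpNorm (dilatedGaussian V k) q =
      eLpNorm (dilatedGaussian V 0) q := by
  have h : (⇑(dilatedGaussian V k) : V → ℂ) = fun x => dilatedGaussian V 0 ((2 : ℝ) ^ k • x) := by
    ext x
    rw [dilatedGaussian_apply, dilatedGaussian_apply, norm_smul, pow_zero, one_mul, norm_pow,
      Real.norm_of_nonneg zero_le_two]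
  rw [h, eLpNorm_comp_smul_of_pos (dilatedGaussian V 0).continuous.aestronglyMeasurable
    (by positivity), ← mul_assoc, ← ENNReal.ofReal_mul (by positivity), ← Real.rpow_natCast,
    ← Real.rpow_mul zero_le_two, ← Real.rpow_add (by norm_num), mul_neg, add_neg_cancel,
    Real.rpow_zero, ENNReal.ofReal_one, one_mul]

theorem le_eLpNorm_gaussianSeries {q : ℝ≥0∞} (hq : 1 ≤ q) (hq' : q ≠ ∞) (n : ℕ) :
    ENNReal.ofReal ((n : ℝ) ^ q⁻¹.toReal) * eLpNorm (dilatedGaussian V 0) q ≤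
      eLpNorm (gaussianSeries V q⁻¹.toReal n) q := by
  have hr : 1 ≤ q.toReal := by
    rw [← ENNReal.toReal_one]; exact ENNReal.toReal_mono hq' hq
  have hr0 : 0 < q.toReal := one_pos.trans_le hr
  have hqr : ENNReal.ofReal q.toReal = q := ENNReal.ofReal_toReal hq'
  have h_rpow (f : V → ℂ) : ∫⁻ x, ‖f x‖ₑ ^ q.toReal = eLpNorm f q ^ q.toReal := by
    rw [lintegral_enorm_rpow_eq_eLpNorm f hr0, hqr]
  set τ := q⁻¹.toReal
  have hτ : τ * q.toReal = 1 := by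
    rw [show τ = q.toReal⁻¹ from ENNReal.toReal_inv q, inv_mul_cancel₀ hr0.ne']
  set c : ℕ → ℝ := fun k => (2 : ℝ) ^ (k * (finrank ℝ V * τ))
  have hc : ∀ k, 0 ≤ c k := fun k => by positivity
  have hk (k : ℕ) : ∫⁻ x : V, (ENNReal.ofReal (c k) * ‖dilatedGaussian V k x‖ₑ) ^ q.toReal =
      eLpNorm (dilatedGaussian V 0) q ^ q.toReal := by
    rw [← eLpNorm_dilatedGaussian q k, ENNReal.mul_rpow_of_nonneg _ _ hr0.le, ← h_rpow,
      ← lintegral_const_mul _ ((dilatedGaussian V k).continuous.measurable.enorm.pow_const _)]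
    exact lintegral_congr fun x => ENNReal.mul_rpow_of_nonneg _ _ hr0.le
  generalize eLpNorm (dilatedGaussian V 0) q = E at hk ⊢
  have key : (n : ℝ≥0∞) * E ^ q.toReal ≤ eLpNorm (gaussianSeries V τ n) q ^ q.toReal := by
    calc (n : ℝ≥0∞) * E ^ q.toReal
        = ∑ k ∈ Finset.range n, ∫⁻ x : V,
            (ENNReal.ofReal (c k) * ‖dilatedGaussian V k x‖ₑ) ^ q.toReal := by
          rw [Finset.sum_congr rfl fun k _ => hk k, Finset.sum_const, Finset.card_range,
            nsmul_eq_mul]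
      _ = ∫⁻ x : V, ∑ k ∈ Finset.range n,
            (ENNReal.ofReal (c k) * ‖dilatedGaussian V k x‖ₑ) ^ q.toReal := by
          rw [lintegral_finsetSum]
          exact fun k _ => ((dilatedGaussian V k).continuous.measurable.enorm.const_mul _).pow_const _
      _ ≤ ∫⁻ x : V, ‖gaussianSeries V τ n x‖ₑ ^ q.toReal := by
          refine lintegral_mono fun x => (sum_rpow_le_rpow_sum hr _ _).trans_eq ?_
          congr 1
          rw [gaussianSeries_apply, ← ofReal_norm, Complex.norm_real,
            Real.norm_of_nonneg (by positivity),
            ENNReal.ofReal_sum_of_nonneg fun k _ => by positivity]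
          refine Finset.sum_congr rfl fun k _ => ?_
          rw [dilatedGaussian_apply, ← ofReal_norm, Complex.norm_real,
            Real.norm_of_nonneg (by positivity), ENNReal.ofReal_mul (hc k)]
      _ = _ := h_rpow _
  rw [← ENNReal.rpow_le_rpow_iff hr0, ENNReal.mul_rpow_of_nonneg _ _ hr0.le,
    ENNReal.ofReal_rpow_of_nonneg (by positivity) hr0.le, ← Real.rpow_mul (by positivity), hτ,
    Real.rpow_one, ENNReal.ofReal_natCast]
  exact key

theorem IsHeisenbergConstant.le_and_ne_top [Nontrivial V] {p q : ℝ≥0∞} (hp : 1 ≤ p) (hq : 1 ≤ q)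
    {α β C : ℝ} (hα : 0 < α) (hβ : 0 < β) (h : IsHeisenbergConstant V p q α β C)
    (hβe : β = finrank ℝ V * (1 - q⁻¹.toReal - p⁻¹.toReal)) : p ≤ q ∧ q ≠ ∞ := by
  have hfin : (0 : ℝ) < finrank ℝ V := by exact_mod_cast finrank_pos
  obtain ⟨K, hK, hU⟩ := exists_eLpNorm_dyadic_le (V := V) hp hβ
    (a := finrank ℝ V * (q⁻¹.toReal - 1)) (by rw [hβe]; linarith)
  have hup (n : ℕ) : eLpNorm (gaussianSeries V q⁻¹.toReal n) q ≤
      ENNReal.ofReal (max C 0 * K * (n : ℝ) ^ p⁻¹.toReal) := by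
    refine (h.eLpNorm_le_of_eq hα hβe _).trans ?_
    rw [mul_assoc, ENNReal.ofReal_mul (le_max_right _ _)]
    exact mul_le_mul' (ENNReal.ofReal_le_ofReal (le_max_left _ _))
      (hU n _ (norm_fourier_gaussianSeries_le _ n))
  by_contra hcon
  by_cases hqt : q = ∞
  · subst hqt
    have hσ : p⁻¹.toReal < 1 := by
      rw [ENNReal.inv_top, ENNReal.toReal_zero, sub_zero] at hβe
      have : 0 < 1 - p⁻¹.toReal := pos_of_mul_pos_right (hβe ▸ hβ) hfin.le
      linarith
    refine not_forall_natCast_rpow_mul_le hσ (one_ne_zero (α := ℝ≥0∞)) fun n => (hup n).trans' ?_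
    refine le_of_eq_of_le ?_ (enorm_le_eLpNorm_top (gaussianSeries V _ n).continuous 0)
    rw [gaussianSeries_apply, ← ofReal_norm, Complex.norm_real,
      Real.norm_of_nonneg (by positivity)]
    simp
  · have hqp : q < p := by
      by_contra hh
      exact hcon ⟨not_lt.1 hh, hqt⟩
    have hlt : p⁻¹.toReal < q⁻¹.toReal :=
      ENNReal.toReal_strict_mono (ENNReal.inv_ne_top.2 (one_pos.trans_le hq).ne')
        (ENNReal.inv_lt_inv.2 hqp)
    exact not_forall_natCast_rpow_mul_le hlt
      (eLpNorm_schwartzGaussian_pos (V := V) _ (one_pos.trans_le hq).ne').ne'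
      fun n => (le_eLpNorm_gaussianSeries hq hqt n).trans (hup n)

end

section RandomSigns

/-- The sign attached to the index `k` by the set `S` of indices. -/
noncomputable def setSign (S : Finset ℕ) (k : ℕ) : ℂ := if k ∈ S then 1 else -1

theorem norm_setSign (S : Finset ℕ) (k : ℕ) : ‖setSign S k‖ = 1 := by
  unfold setSign; split <;> simp

theorem sum_powerset_insert_setSign {s : Finset ℕ} {a : ℕ} (ha : a ∉ s) (z : ℕ → ℂ) (φ : ℂ → ℝ) :
    ∑ S ∈ (insert a s).powerset, φ (∑ k ∈ insert a s, setSign S k * z k) =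
      ∑ S ∈ s.powerset, (φ ((∑ k ∈ s, setSign S k * z k) + z a) +
        φ ((∑ k ∈ s, setSign S k * z k) - z a)) := by
  rw [Finset.sum_powerset_insert ha, ← Finset.sum_add_distrib]
  refine Finset.sum_congr rfl fun S hS => ?_
  have haS : a ∉ S := fun h => ha (Finset.mem_powerset.1 hS h)
  rw [add_comm, Finset.sum_insert ha, Finset.sum_insert ha]
  have h1 : ∑ k ∈ s, setSign (insert a S) k * z k = ∑ k ∈ s, setSign S k * z k := by
    refine Finset.sum_congr rfl fun k hk => ?_
    have : k ≠ a := fun h => ha (h ▸ hk)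
    simp [setSign, this]
  rw [h1]
  congr 2
  · simp [setSign, add_comm]
  · simp only [setSign, haS, if_false]
    ring

theorem sum_powerset_norm_sq (s : Finset ℕ) (z : ℕ → ℂ) :
    ∑ S ∈ s.powerset, ‖∑ k ∈ s, setSign S k * z k‖ ^ 2 = 2 ^ s.card * ∑ k ∈ s, ‖z k‖ ^ 2 := by
  induction s using Finset.induction_on with
  | empty => simp
  | insert a s ha ih =>
    rw [sum_powerset_insert_setSign ha z (fun w => ‖w‖ ^ 2), Finset.sum_insert ha,
      Finset.card_insert_of_notMem ha]
    have (w : ℂ) : ‖w + z a‖ ^ 2 + ‖w - z a‖ ^ 2 = 2 * ‖w‖ ^ 2 + 2 * ‖z a‖ ^ 2 := by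
      have := parallelogram_law_with_norm ℝ w (z a)
      linarith
    simp only [this, Finset.sum_add_distrib, ← Finset.mul_sum, ih, Finset.sum_const,
      Finset.card_powerset, nsmul_eq_mul]
    push_cast
    ring

theorem norm_add_pow_four_add_norm_sub_pow_four_le (w z : ℂ) :
    ‖w + z‖ ^ 4 + ‖w - z‖ ^ 4 ≤ 2 * ‖w‖ ^ 4 + 12 * (‖w‖ ^ 2 * ‖z‖ ^ 2) + 2 * ‖z‖ ^ 4 := by
  have h1 := norm_add_sq_real w z
  have h2 := norm_sub_sq_real w z
  have h3 : inner ℝ w z ^ 2 ≤ ‖w‖ ^ 2 * ‖z‖ ^ 2 := by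
    rw [← mul_pow, sq_le_sq, abs_of_nonneg (a := ‖w‖ * ‖z‖) (by positivity)]
    exact abs_real_inner_le_norm w z
  calc ‖w + z‖ ^ 4 + ‖w - z‖ ^ 4 = (‖w + z‖ ^ 2) ^ 2 + (‖w - z‖ ^ 2) ^ 2 := by ring
    _ = 2 * (‖w‖ ^ 2 + ‖z‖ ^ 2) ^ 2 + 8 * inner ℝ w z ^ 2 := by rw [h1, h2]; ring
    _ ≤ _ := by linarith

theorem sum_powerset_norm_pow_four_le (s : Finset ℕ) (z : ℕ → ℂ) :
    ∑ S ∈ s.powerset, ‖∑ k ∈ s, setSign S k * z k‖ ^ 4 ≤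
      2 ^ s.card * (3 * (∑ k ∈ s, ‖z k‖ ^ 2) ^ 2) := by
  induction s using Finset.induction_on with
  | empty => simp
  | insert a s ha ih =>
    rw [sum_powerset_insert_setSign ha z (fun w => ‖w‖ ^ 4), Finset.sum_insert ha,
      Finset.card_insert_of_notMem ha]
    refine (Finset.sum_le_sum fun S _ => norm_add_pow_four_add_norm_sub_pow_four_le _ _).trans ?_
    simp only [Finset.sum_add_distrib, ← Finset.mul_sum, ← Finset.sum_mul, sum_powerset_norm_sq,
      Finset.sum_const, Finset.card_powerset, nsmul_eq_mul]
    push_cast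
    have h0 : 0 ≤ (2 : ℝ) ^ s.card * ‖z a‖ ^ 4 := by positivity
    rw [pow_succ]
    linear_combination 2 * ih + 4 * h0

theorem sub_le_rpow {t r : ℝ} (ht : 0 ≤ t) (hr1 : 1 ≤ r) (hr2 : r ≤ 2) :
    t ^ 2 - t ^ 4 / 6 ≤ t ^ r := by
  rcases le_total t 1 with h | h
  · rcases ht.eq_or_lt with rfl | h0
    · rw [Real.zero_rpow (by linarith)]; norm_num
    · have : t ^ 2 ≤ t ^ r := by
        rw [← Real.rpow_two]; exact Real.rpow_le_rpow_of_exponent_ge h0 h hr2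
      have : 0 ≤ t ^ 4 := by positivity
      linarith
  · have : t ≤ t ^ r := by
      simpa using Real.rpow_le_rpow_of_exponent_le h hr1
    nlinarith [mul_nonneg ht (mul_nonneg (by linarith : 0 ≤ t + 3) (sq_nonneg (2 * t - 3))),
      mul_nonneg ht (mul_nonneg (by linarith : 0 ≤ t + 3) (sq_nonneg (t - 1)))]

theorem rpow_le_one_add_sq {t r : ℝ} (ht : 0 ≤ t) (hr0 : 0 ≤ r) (hr2 : r ≤ 2) :
    t ^ r ≤ 1 + t ^ 2 := by
  rcases le_total t 1 with h | h
  · have := Real.rpow_le_one ht h hr0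
    nlinarith
  · have : t ^ r ≤ t ^ 2 := by
      rw [← Real.rpow_two]; exact Real.rpow_le_rpow_of_exponent_le h hr2
    linarith

variable {s : Finset ℕ} {z : ℕ → ℂ} {ρ r : ℝ}

theorem sum_powerset_norm_rpow_of_norm_le (hr1 : 1 ≤ r) (hr2 : r ≤ 2) (hρ : 0 < ρ)
    (hz : ∑ k ∈ s, ‖z k‖ ^ 2 = ρ ^ 2) :
    2 ^ s.card * (ρ ^ r / 2) ≤ ∑ S ∈ s.powerset, ‖∑ k ∈ s, setSign S k * z k‖ ^ r ∧
      ∑ S ∈ s.powerset, ‖∑ k ∈ s, setSign S k * z k‖ ^ r ≤ 2 ^ s.card * (2 * ρ ^ r) := by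
  have e (S : Finset ℕ) : ‖∑ k ∈ s, setSign S k * z k‖ ^ r =
      ρ ^ r * (‖∑ k ∈ s, setSign S k * z k‖ / ρ) ^ r := by
    rw [← Real.mul_rpow hρ.le (by positivity), mul_div_cancel₀ _ hρ.ne']
  have h2 : ∑ S ∈ s.powerset, (‖∑ k ∈ s, setSign S k * z k‖ / ρ) ^ 2 = 2 ^ s.card := by
    simp only [div_pow]
    rw [← Finset.sum_div, sum_powerset_norm_sq, hz, mul_div_cancel_right₀ _ (by positivity)]
  have h4 : ∑ S ∈ s.powerset, (‖∑ k ∈ s, setSign S k * z k‖ / ρ) ^ 4 ≤ 2 ^ s.card * 3 := by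
    simp only [div_pow]
    rw [← Finset.sum_div, div_le_iff₀ (by positivity)]
    refine (sum_powerset_norm_pow_four_le s z).trans_eq ?_
    rw [hz]; ring
  simp only [e]
  rw [← Finset.mul_sum]
  constructor
  · have := Finset.sum_le_sum fun S (_ : S ∈ s.powerset) =>
      sub_le_rpow (t := ‖∑ k ∈ s, setSign S k * z k‖ / ρ) (by positivity) hr1 hr2
    rw [Finset.sum_sub_distrib, h2, ← Finset.sum_div] at this
    calc 2 ^ s.card * (ρ ^ r / 2) = ρ ^ r * (2 ^ s.card / 2) := by ring
      _ ≤ _ := by gcongr; linarith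
  · have := Finset.sum_le_sum fun S (_ : S ∈ s.powerset) =>
      rpow_le_one_add_sq (t := ‖∑ k ∈ s, setSign S k * z k‖ / ρ) (by positivity)
        (zero_le_one.trans hr1) hr2
    rw [Finset.sum_add_distrib, h2, Finset.sum_const, Finset.card_powerset, nsmul_eq_mul] at this
    push_cast at this
    calc _ ≤ ρ ^ r * (2 ^ s.card * 1 + 2 ^ s.card) := by gcongr
      _ = _ := by ring

end RandomSigns

section

variable {V : Type*} [NormedAddCommGroup V] [InnerProductSpace ℝ V] [FiniteDimensional ℝ V]
  [MeasurableSpace V] [BorelSpace V]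

/-- Khintchine's inequality, integrated against two weights at the same time. -/
theorem exists_sign_sum_integral_le {r α : ℝ} (hr1 : 1 ≤ r) (hr2 : r ≤ 2) (hα : 0 ≤ α)
    (g : ℕ → SchwartzMap V ℂ) {G : V → ℝ} (hG : ∀ x, 0 < G x) (hg : ∀ k x, ‖g k x‖ = G x) :
    ∃ δ A : ℝ, 0 < δ ∧ 0 < A ∧ ∀ n : ℕ, ∃ S : Finset ℕ,
      δ * (∫ x, (‖x‖ ^ α * ‖(∑ k ∈ Finset.range n, setSign S k • g k) x‖) ^ r) +
          A * ((n : ℝ) ^ (1 / 2 : ℝ)) ^ r ≤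
        ∫ x, ‖(∑ k ∈ Finset.range n, setSign S k • g k) x‖ ^ r := by
  have hr0 : 0 < r := one_pos.trans_le hr1
  have hI (f : SchwartzMap V ℂ) : Integrable fun x => ‖f x‖ ^ r := by
    have := (f.memLp (μ := volume) (ENNReal.ofReal r)).integrable_norm_rpow
      (by simpa using hr0) ENNReal.ofReal_ne_top
    rwa [ENNReal.toReal_ofReal hr0.le] at this
  have hJ (f : SchwartzMap V ℂ) : Integrable fun x => (‖x‖ ^ α * ‖f x‖) ^ r := by
    have := (memLp_norm_rpow_mul_norm f hα (ENNReal.ofReal r)).integrable_norm_rpow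
      (by simpa using hr0) ENNReal.ofReal_ne_top
    rw [ENNReal.toReal_ofReal hr0.le] at this
    refine this.congr (Eventually.of_forall fun x => ?_)
    simp only
    rw [Real.norm_of_nonneg (by positivity)]
  have hIG : Integrable fun x => G x ^ r := by simpa only [hg] using hI (g 0)
  have hJG : Integrable fun x => (‖x‖ ^ α * G x) ^ r := by simpa only [hg] using hJ (g 0)
  set A₀ := ∫ x, G x ^ r
  set B₀ := ∫ x, (‖x‖ ^ α * G x) ^ r
  have hA₀ : 0 < A₀ := by
    rw [integral_pos_iff_support_of_nonneg (fun x => Real.rpow_nonneg (hG x).le r) hIG]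
    have : Function.support (fun x => G x ^ r) = univ :=
      eq_univ_of_forall fun x => (Real.rpow_pos_of_pos (hG x) r).ne'
    rw [this]
    exact isOpen_univ.measure_pos _ univ_nonempty
  have hB₀ : 0 ≤ B₀ := integral_nonneg fun x => by
    have := hG x
    positivity
  refine ⟨A₀ / (8 * (B₀ + 1)), A₀ / 4, by positivity, by positivity, fun n => ?_⟩
  by_contra! hcon
  set f : Finset ℕ → SchwartzMap V ℂ := fun S => ∑ k ∈ Finset.range n, setSign S k • g k with hf
  have hfx (S : Finset ℕ) (x : V) : f S x = ∑ k ∈ Finset.range n, setSign S k * g k x := by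
    simp [hf]
  have hcon' : ∀ S, ∫ x, ‖f S x‖ ^ r < A₀ / (8 * (B₀ + 1)) * (∫ x, (‖x‖ ^ α * ‖f S x‖) ^ r) +
    A₀ / 4 * ((n : ℝ) ^ (1 / 2 : ℝ)) ^ r := hcon
  rcases n.eq_zero_or_pos with rfl | hn
  · have := hcon ∅
    simp [Real.zero_rpow hr0.ne'] at this
  have hn0 : 0 < (n : ℝ) := by exact_mod_cast hn
  set N : ℝ := (n : ℝ) ^ (1 / 2 : ℝ) with hN
  have hN0 : 0 < N := by positivity
  have hNn : N ^ 2 = n := by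
    rw [hN, ← Real.rpow_natCast, ← Real.rpow_mul hn0.le]; norm_num
  have hpt (x : V) := sum_powerset_norm_rpow_of_norm_le (s := Finset.range n)
    (z := fun k => g k x) (ρ := N * G x) hr1 hr2 (mul_pos hN0 (hG x)) (by simp [hg, mul_pow, hNn])
  simp only [← hfx, Finset.card_range, Real.mul_rpow hN0.le (hG _).le] at hpt
  have h1 : 2 ^ n * N ^ r * (A₀ / 2) ≤ ∑ S ∈ (Finset.range n).powerset, ∫ x, ‖f S x‖ ^ r := by
    rw [← integral_finsetSum _ fun S _ => hI (f S), mul_div_assoc', mul_div_right_comm,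
      ← integral_const_mul]
    refine integral_mono (hIG.const_mul _) (integrable_finsetSum _ fun S _ => hI (f S)) fun x => ?_
    exact (hpt x).1.trans_eq' (by ring)
  have h2 : ∑ S ∈ (Finset.range n).powerset, ∫ x, (‖x‖ ^ α * ‖f S x‖) ^ r ≤
      2 ^ n * N ^ r * (2 * B₀) := by
    rw [← integral_finsetSum _ fun S _ => hJ (f S), ← mul_assoc, ← integral_const_mul]
    refine integral_mono (integrable_finsetSum _ fun S _ => hJ (f S)) (hJG.const_mul _) fun x => ?_
    have hw : 0 ≤ ‖x‖ ^ α := by positivity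
    simp only [Real.mul_rpow hw (norm_nonneg _), Real.mul_rpow hw (hG x).le]
    rw [← Finset.mul_sum]
    calc _ ≤ (‖x‖ ^ α) ^ r * (2 ^ n * (2 * (N ^ r * G x ^ r))) := by gcongr; exact (hpt x).2
      _ = _ := by ring
  have h3 := Finset.sum_lt_sum_of_nonempty (s := (Finset.range n).powerset)
    ⟨∅, Finset.empty_mem_powerset _⟩ fun S _ => hcon' S
  rw [Finset.sum_add_distrib, ← Finset.mul_sum, Finset.sum_const, Finset.card_powerset,
    Finset.card_range, nsmul_eq_mul] at h3
  rw [Nat.cast_pow, Nat.cast_ofNat] at h3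
  have h4 : A₀ / (8 * (B₀ + 1)) * (2 * B₀) ≤ A₀ / 4 := by
    rw [div_mul_eq_mul_div, div_le_div_iff₀ (by positivity) (by norm_num)]
    nlinarith
  have hP : 0 < 2 ^ n * N ^ r := by positivity
  have h5 := mul_le_mul_of_nonneg_left h2 (by positivity : 0 ≤ A₀ / (8 * (B₀ + 1)))
  have h6 := mul_le_mul_of_nonneg_left h4 hP.le
  linarith

theorem exists_sign_sum_eLpNorm_le {q : ℝ≥0∞} {α : ℝ} (hq1 : 1 ≤ q) (hq2 : q ≤ 2) (hα : 0 ≤ α)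
    (g : ℕ → SchwartzMap V ℂ) {G : V → ℝ} (hG : ∀ x, 0 < G x) (hg : ∀ k x, ‖g k x‖ = G x) :
    ∃ δ A : ℝ, 0 < δ ∧ 0 < A ∧ ∀ n : ℕ, ∃ S : Finset ℕ,
      δ * (eLpNorm (fun x => ‖x‖ ^ α * ‖(∑ k ∈ Finset.range n, setSign S k • g k) x‖) q).toReal ≤
        (eLpNorm (⇑(∑ k ∈ Finset.range n, setSign S k • g k)) q).toReal ∧
      A * (n : ℝ) ^ (1 / 2 : ℝ) ≤
        (eLpNorm (⇑(∑ k ∈ Finset.range n, setSign S k • g k)) q).toReal := by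
  have hqt : q ≠ ∞ := (hq2.trans_lt ENNReal.ofNat_lt_top).ne
  have hq0 : q ≠ 0 := (one_pos.trans_le hq1).ne'
  have hr1 : 1 ≤ q.toReal := by rw [← ENNReal.toReal_one]; exact ENNReal.toReal_mono hqt hq1
  have hr2 : q.toReal ≤ 2 := by
    rw [← ENNReal.toReal_ofNat]; exact ENNReal.toReal_mono ENNReal.ofNat_ne_top hq2
  set r := q.toReal with hr
  have hr0 : 0 < r := one_pos.trans_le hr1
  obtain ⟨δ, A, hδ, hA, h⟩ := exists_sign_sum_integral_le hr1 hr2 hα g hG hg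
  refine ⟨δ ^ r⁻¹, A ^ r⁻¹, by positivity, by positivity, fun n => ?_⟩
  obtain ⟨S, hS⟩ := h n
  refine ⟨S, ?_⟩
  set f := ∑ k ∈ Finset.range n, setSign S k • g k
  have h1 := (f.memLp (μ := volume) q).eLpNorm_eq_integral_rpow_norm hq0 hqt
  have h2 := (memLp_norm_rpow_mul_norm f hα q).eLpNorm_eq_integral_rpow_norm hq0 hqt
  have e (x : V) : ‖‖x‖ ^ α * ‖f x‖‖ = ‖x‖ ^ α * ‖f x‖ := Real.norm_of_nonneg (by positivity)
  simp only [e] at h2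
  have hI : 0 ≤ ∫ x, ‖f x‖ ^ r := by positivity
  have hJ : 0 ≤ ∫ x, (‖x‖ ^ α * ‖f x‖) ^ r := by positivity
  have hN : 0 ≤ ((n : ℝ) ^ (1 / 2 : ℝ)) ^ r := by positivity
  rw [h1, h2, ENNReal.toReal_ofReal (by positivity), ENNReal.toReal_ofReal (by positivity)]
  rw [← hr]
  have hδJ := mul_nonneg hδ.le hJ
  have hAN := mul_nonneg hA.le hN
  constructor
  · rw [← Real.mul_rpow hδ.le hJ]
    refine Real.rpow_le_rpow (by positivity) ?_ (by positivity)
    linarith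
  · rw [← Real.rpow_rpow_inv (x := (n : ℝ) ^ (1 / 2 : ℝ)) (by positivity) hr0.ne',
      ← Real.mul_rpow hA.le hN]
    refine Real.rpow_le_rpow (by positivity) ?_ (by positivity)
    linarith

/-- The chirped Gaussian `exp (-π (1 - i λ) ‖x‖²)` with `λ = √(4 ^ k - 1)`. -/
noncomputable def chirp (V : Type*) [NormedAddCommGroup V] [InnerProductSpace ℝ V] (k : ℕ) :
    SchwartzMap V ℂ :=
  schwartzGaussian V (b := ⟨Real.pi, -Real.pi * √(4 ^ k - 1)⟩) Real.pi_pos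

theorem norm_chirp (k : ℕ) (x : V) : ‖chirp V k x‖ = Real.exp (-Real.pi * ‖x‖ ^ 2) := by
  rw [chirp, schwartzGaussian_apply, norm_cexp_neg_mul_sq]

theorem norm_fourier_chirp (k : ℕ) (ξ : V) :
    ‖𝓕 (⇑(chirp V k)) ξ‖ =
      (2 : ℝ) ^ (k * (-(finrank ℝ V : ℝ) / 2)) * Real.exp (-Real.pi * (‖ξ‖ / 2 ^ k) ^ 2) := by
  have hb : ‖(⟨Real.pi, -Real.pi * √(4 ^ k - 1)⟩ : ℂ)‖ = Real.pi * 2 ^ k := by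
    have h4 : (1 : ℝ) ≤ 4 ^ k := one_le_pow₀ (by norm_num)
    rw [← sq_eq_sq₀ (norm_nonneg _) (by positivity), Complex.sq_norm, Complex.normSq_mk,
      mul_mul_mul_comm, Real.mul_self_sqrt (by linarith), mul_pow, ← pow_mul, mul_comm k 2, pow_mul]
    norm_num
    ring
  rw [chirp, norm_fourier_schwartzGaussian, hb]
  congr 1
  · rw [div_mul_cancel_left₀ Real.pi_ne_zero, ← Real.rpow_natCast, ← Real.rpow_neg (by positivity),
      ← Real.rpow_mul (by positivity)]
    congr 1
    ring
  · congr 1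
    field_simp

theorem IsHeisenbergConstant.lt_exponent_of_lt_two [Nontrivial V] {p q : ℝ≥0∞} (hq1 : 1 ≤ q)
    (hq2 : q < 2) (hp : 2 < p) {α β C : ℝ} (hα : 0 < α) (hβ : 0 < β)
    (h : IsHeisenbergConstant V p q α β C) : finrank ℝ V * (1 / 2 - p⁻¹.toReal) < β := by
  by_contra! hle
  obtain ⟨K, hK, hU⟩ := exists_eLpNorm_dyadic_le (V := V) (p := p)
    (one_le_two.trans hp.le) hβ (a := -(finrank ℝ V : ℝ) / 2) (by linarith)
  obtain ⟨δ, A, hδ, hA, hS⟩ := exists_sign_sum_eLpNorm_le (V := V) hq1 hq2.le hα.le (chirp V)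
    (G := fun x => Real.exp (-Real.pi * ‖x‖ ^ 2)) (fun x => Real.exp_pos _) norm_chirp
  have hσ : p⁻¹.toReal < 1 / 2 := by
    have := ENNReal.toReal_strict_mono (by simp) (ENNReal.inv_lt_inv.2 hp)
    simpa using this
  set M := max C 0
  have hM : 0 ≤ M := le_max_right _ _
  obtain ⟨R, hRδ, hR⟩ : ∃ R : ℝ, M * R ^ (-α) ≤ δ / 2 ∧ 0 < R := by
    have ht := (tendsto_rpow_neg_atTop hα).const_mul M
    rw [mul_zero] at ht
    exact ((ht.eventually_le_const (by positivity)).and (eventually_gt_atTop 0)).exists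
  set L := R ^ (β - finrank ℝ V * (1 - q⁻¹.toReal - p⁻¹.toReal))
  have hL : 0 ≤ L := by positivity
  refine not_forall_natCast_rpow_mul_le (K := 2 * M * L * K) hσ
    (ENNReal.ofReal_pos.2 hA).ne' fun n => ?_
  obtain ⟨S, h1, h2⟩ := hS n
  set f := ∑ k ∈ Finset.range n, setSign S k • chirp V k
  have hF : eLpNorm (fun ξ => ‖ξ‖ ^ β * ‖𝓕 (⇑f) ξ‖) p ≤
      ENNReal.ofReal (K * (n : ℝ) ^ p⁻¹.toReal) := by
    refine hU n _ fun ξ => (norm_fourier_sum_smul_le _ _ _ ξ).trans_eq ?_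
    simp only [norm_setSign, norm_fourier_chirp, one_mul]
  have hsc := h.scale f hR
  have hX := (f.memLp (μ := volume) q).eLpNorm_ne_top
  have hY := (memLp_norm_rpow_mul_norm f hα.le q).eLpNorm_ne_top
  rw [← ENNReal.ofReal_toReal hX, ← ENNReal.ofReal_toReal hY] at hsc
  have hx0 : 0 ≤ (eLpNorm f q).toReal := ENNReal.toReal_nonneg
  have hy0 : 0 ≤ (eLpNorm (fun x => ‖x‖ ^ α * ‖f x‖) q).toReal := ENNReal.toReal_nonneg
  generalize (eLpNorm f q).toReal = x at *
  generalize (eLpNorm (fun x => ‖x‖ ^ α * ‖f x‖) q).toReal = y at *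
  have hfin : x ≤ M * (R ^ (-α) * y + L * (K * (n : ℝ) ^ p⁻¹.toReal)) := by
    rw [← ENNReal.ofReal_le_ofReal_iff (by positivity), ENNReal.ofReal_mul hM,
      ENNReal.ofReal_add (by positivity) (by positivity), ENNReal.ofReal_mul (by positivity),
      ENNReal.ofReal_mul hL]
    refine hsc.trans (mul_le_mul' (ENNReal.ofReal_le_ofReal (le_max_left _ _))
      (add_le_add_right (mul_le_mul_right hF _) _))
  rw [← ENNReal.ofReal_mul (by positivity)]
  refine ENNReal.ofReal_le_ofReal ?_
  have h3 := mul_le_mul_of_nonneg_right hRδ hy0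
  nlinarith

end

end NonsymmetricHeisenberg

/-- Non-symmetric Heisenberg uncertainty principle (Theorem 1.1):
characterization of `‖f‖_q ≲ ‖|x|^α f‖_q + ‖|ξ|^β f̂‖_p` for Schwartz functions. -/
theorem heisenberg_nonsymmetric_characterization
    (d : ℕ) (hd : 1 ≤ d) (p q : ℝ≥0∞) (hp : 1 ≤ p) (hq : 1 ≤ q)
    (α β : ℝ) (hα : 0 < α) (hβ : 0 < β) :
    (∃ C : ℝ, 0 < C ∧
      ∀ f : SchwartzMap (EuclideanSpace ℝ (Fin d)) ℂ,
        eLpNorm (⇑f) q volume ≤ ENNReal.ofReal C *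
          (eLpNorm (fun x => ‖x‖ ^ α * ‖f x‖) q volume +
            eLpNorm (fun ξ => ‖ξ‖ ^ β * ‖𝓕 (⇑f) ξ‖) p volume)) ↔
    (((p ≤ q ∧ q ≠ ∞ ∧ β = (d : ℝ) * (1 - (1/q).toReal - (1/p).toReal)) ∨
        β > (d : ℝ) * (1 - (1/q).toReal - (1/p).toReal)) ∧
      (2 ≤ q ∨ (p ≤ 2 ∧ q ≤ 2) ∨
        (q < 2 ∧ 2 < p ∧ β > (d : ℝ) * (1/2 - (1/p).toReal)))) := by
  have : NeZero d := ⟨(Nat.one_le_iff_ne_zero.1 hd)⟩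
  have hfin : (d : ℝ) = Module.finrank ℝ (EuclideanSpace ℝ (Fin d)) := by
    rw [finrank_euclideanSpace_fin]
  rw [one_div q, one_div p, hfin]
  constructor
  · rintro ⟨C, -, h⟩
    have hC : NonsymmetricHeisenberg.IsHeisenbergConstant (EuclideanSpace ℝ (Fin d)) p q α β C := h
    refine ⟨?_, ?_⟩
    · rcases (hC.le_exponent (one_pos.trans_le hq).ne' hα hβ).eq_or_lt with he | hlt
      · obtain ⟨h1, h2⟩ := hC.le_and_ne_top hp hq hα hβ he.symm
        exact Or.inl ⟨h1, h2, he.symm⟩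
      · exact Or.inr hlt
    · rcases le_or_gt 2 q with h2 | h2
      · exact Or.inl h2
      · rcases le_or_gt p 2 with hp2 | hp2
        · exact Or.inr (Or.inl ⟨hp2, h2.le⟩)
        · exact Or.inr (Or.inr ⟨h2, hp2, hC.lt_exponent_of_lt_two hq h2 hp2 hα hβ⟩)
  · rintro ⟨hA, hB⟩
    exact NonsymmetricHeisenberg.exists_heisenberg_inequality hp hq hα hβ hA
      (hB.imp_right (Or.imp And.left fun h => h.2.2))
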